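/- Let p > 1, μ ∈ ℝ, and let k ∈ C(Ω) be nonnegative. Let u₁ ≥ 0 and u₂ ≥ 0 in Ω satisfy, in the viscosity sense, F(x,D²u₁)+μu₁ ≤ k(x)u₁^p and F(x,D²u₂)+μu₂ ≥ k(x)u₂^p in Ω. If u₁ ≥ u₂ in Ω, then either u₁ > u₂ everywhere in Ω or u₁ ≡ u₂ in Ω. -/

import Mathlib

open scoped Matrix Topology
open Bornology MeasureTheory

noncomputable section

/-- Euclidean space `ℝ^N`. -/
abbrev Euc (N : ℕ) := EuclideanSpace ℝ (Fin N)

/-- The Hessian matrix of a (test) function `φ` at `x`, with entries the second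
partial derivatives in the coordinate directions. -/
def hessianMatrix {N : ℕ} (φ : Euc N → ℝ) (x : Euc N) : Matrix (Fin N) (Fin N) ℝ :=
  Matrix.of fun i j =>
    iteratedFDeriv ℝ 2 φ x ![EuclideanSpace.single i (1 : ℝ), EuclideanSpace.single j (1 : ℝ)]

/-- Loewner (partial) order on real square matrices: `A ≤ B` iff `B - A` is positive
semidefinite. -/
def MatLE {n : Type*} [Fintype n] (A B : Matrix n n ℝ) : Prop := (B - A).PosSemidef

/-- `u` is a viscosity subsolution of `G(x, u, D²u) ≥ 0` on `Ω`: at any interior point where a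
`C²` function `φ` touches `u` from above, `G(x₀, u(x₀), D²φ(x₀)) ≥ 0`. -/
def ViscSubsol {N : ℕ} (Ω : Set (Euc N))
    (G : Euc N → ℝ → Matrix (Fin N) (Fin N) ℝ → ℝ) (u : Euc N → ℝ) : Prop :=
  ∀ x₀ ∈ Ω, ∀ φ : Euc N → ℝ, ContDiff ℝ 2 φ → u x₀ = φ x₀ →
    IsLocalMaxOn (fun x => u x - φ x) Ω x₀ →
    0 ≤ G x₀ (u x₀) (hessianMatrix φ x₀)

/-- `u` is a viscosity supersolution of `G(x, u, D²u) ≤ 0` on `Ω`: at any interior point where a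
`C²` function `φ` touches `u` from below, `G(x₀, u(x₀), D²φ(x₀)) ≤ 0`. -/
def ViscSupersol {N : ℕ} (Ω : Set (Euc N))
    (G : Euc N → ℝ → Matrix (Fin N) (Fin N) ℝ → ℝ) (u : Euc N → ℝ) : Prop :=
  ∀ x₀ ∈ Ω, ∀ φ : Euc N → ℝ, ContDiff ℝ 2 φ → u x₀ = φ x₀ →
    IsLocalMinOn (fun x => u x - φ x) Ω x₀ →
    G x₀ (u x₀) (hessianMatrix φ x₀) ≤ 0

/-- (F1): uniform ellipticity with ellipticity constants `0 < lam ≤ Lam`. -/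
def IsF1 {N : ℕ} (Ω : Set (Euc N)) (F : Euc N → Matrix (Fin N) (Fin N) ℝ → ℝ)
    (lam Lam : ℝ) : Prop :=
  0 < lam ∧ lam ≤ Lam ∧
    ∀ x ∈ Ω, ∀ X P : Matrix (Fin N) (Fin N) ℝ, X.IsSymm → P.PosSemidef →
      lam * P.trace ≤ F x (X + P) - F x X ∧ F x (X + P) - F x X ≤ Lam * P.trace

/-- (F2): positive 1-homogeneity in the matrix variable. -/
def IsF2 {N : ℕ} (Ω : Set (Euc N)) (F : Euc N → Matrix (Fin N) (Fin N) ℝ → ℝ) : Prop :=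
  ∀ x ∈ Ω, ∀ t : ℝ, 0 ≤ t → ∀ X : Matrix (Fin N) (Fin N) ℝ, F x (t • X) = t * F x X

/-- (F3): the standard structure condition of viscosity solution theory, with a modulus of
continuity `ω`. -/
def IsF3 {N : ℕ} (Ω : Set (Euc N)) (F : Euc N → Matrix (Fin N) (Fin N) ℝ → ℝ) : Prop :=
  ∃ ω : ℝ → ℝ, Monotone ω ∧ ω 0 = 0 ∧ ContinuousAt ω 0 ∧ (∀ t, 0 ≤ ω t) ∧
    ∀ α : ℝ, 0 < α → ∀ x ∈ Ω, ∀ y ∈ Ω, ∀ X Y : Matrix (Fin N) (Fin N) ℝ,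
      X.IsSymm → Y.IsSymm →
      MatLE ((-(3 * α)) • (1 : Matrix (Fin N ⊕ Fin N) (Fin N ⊕ Fin N) ℝ))
        (Matrix.fromBlocks X 0 0 (-Y)) →
      MatLE (Matrix.fromBlocks X 0 0 (-Y))
        ((3 * α) • Matrix.fromBlocks 1 (-1) (-1) 1) →
      F x X - F y Y ≤ ω (α * ‖x - y‖ ^ 2 + ‖x - y‖)

/-- Continuity of `F` on `Ω × 𝒮_N`. -/
def FCont {N : ℕ} (Ω : Set (Euc N)) (F : Euc N → Matrix (Fin N) (Fin N) ℝ → ℝ) : Prop :=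
  ContinuousOn (fun q : Euc N × Matrix (Fin N) (Fin N) ℝ => F q.1 q.2) (Ω ×ˢ Set.univ)

/-- A bounded domain (open, bounded, nonempty, connected set) of class `C²`, described by a
`C²` defining function with nonvanishing gradient on the boundary. -/
def IsC2Domain {N : ℕ} (Ω : Set (Euc N)) : Prop :=
  IsOpen Ω ∧ IsBounded Ω ∧ Ω.Nonempty ∧ IsConnected Ω ∧
    ∃ f : Euc N → ℝ, ContDiff ℝ 2 f ∧ Ω = {x | f x < 0} ∧
      frontier Ω = {x | f x = 0} ∧ ∀ x ∈ frontier Ω, fderiv ℝ f x ≠ 0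

/-- The operator `F(x, M) + μ r` of the eigenvalue problem. -/
def eigenG {N : ℕ} (F : Euc N → Matrix (Fin N) (Fin N) ℝ → ℝ) (μ : ℝ) :
    Euc N → ℝ → Matrix (Fin N) (Fin N) ℝ → ℝ :=
  fun x r M => F x M + μ * r

/-- The principal eigenvalue (à la Berestycki–Nirenberg–Varadhan) of `F` on `D`:
`λ₁⁺(D) = sup {μ : ∃ ψ > 0 in D, F(x, D²ψ) + μψ ≤ 0 in D in the viscosity sense}`. -/
def principalEigenvalue {N : ℕ} (F : Euc N → Matrix (Fin N) (Fin N) ℝ → ℝ)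
    (D : Set (Euc N)) : ℝ :=
  sSup {μ : ℝ | ∃ ψ : Euc N → ℝ, (∀ x ∈ D, 0 < ψ x) ∧ ViscSupersol D (eigenG F μ) ψ}

/-- The logistic operator `F(x, M) + μ r - k(x) r^p`. -/
def logisticG {N : ℕ} (F : Euc N → Matrix (Fin N) (Fin N) ℝ → ℝ) (μ : ℝ)
    (k : Euc N → ℝ) (p : ℝ) : Euc N → ℝ → Matrix (Fin N) (Fin N) ℝ → ℝ :=
  fun x r M => F x M + μ * r - k x * Real.rpow r p

/-- `u` is a (positive, viscosity) solution of problem (1):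
`F(x,D²u) + μ u = k(x) u^p` in `Ω`, `u > 0` in `Ω`, `u = 0` on `∂Ω`. -/
def IsSolP1 {N : ℕ} (Ω : Set (Euc N)) (F : Euc N → Matrix (Fin N) (Fin N) ℝ → ℝ)
    (μ : ℝ) (k : Euc N → ℝ) (p : ℝ) (u : Euc N → ℝ) : Prop :=
  ContinuousOn u (closure Ω) ∧ (∀ x ∈ Ω, 0 < u x) ∧
    ViscSubsol Ω (logisticG F μ k p) u ∧ ViscSupersol Ω (logisticG F μ k p) u ∧
    ∀ x ∈ frontier Ω, u x = 0

/-- Condition (K1): `k` is bounded below by a positive constant on `Ω`. -/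
def CondK1 {N : ℕ} (Ω : Set (Euc N)) (k : Euc N → ℝ) : Prop :=
  ∃ k₀ : ℝ, 0 < k₀ ∧ ∀ x ∈ Ω, k₀ ≤ k x

/-- Condition (K2), with the vanishing subdomain `Ω₀` explicit: `Ω₀` is a `C²` bounded domain
compactly contained in `Ω`, `k = 0` on `closure Ω₀`, and `inf_{Ω \ Ω₁} k > 0` for every open
`Ω₁ ⊊ Ω` compactly containing `Ω₀`. -/
def CondK2 {N : ℕ} (Ω Ω₀ : Set (Euc N)) (k : Euc N → ℝ) : Prop :=
  IsC2Domain Ω₀ ∧ closure Ω₀ ⊆ Ω ∧ (∀ x ∈ closure Ω₀, k x = 0) ∧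
    ∀ Ω₁ : Set (Euc N), IsOpen Ω₁ → Ω₁ ⊆ Ω → Ω₁ ≠ Ω → closure Ω₀ ⊆ Ω₁ →
      ∃ c : ℝ, 0 < c ∧ ∀ x ∈ Ω \ Ω₁, c ≤ k x

/-- The sup norm `‖u‖_{L^∞(S)}`. -/
def supNorm {N : ℕ} (S : Set (Euc N)) (u : Euc N → ℝ) : ℝ := sSup (u '' S)

/-- The Pucci maximal operator `𝓜⁺_{lam,Lam}(M) = sup {tr(A M) : lam I ≤ A ≤ Lam I}`. -/
def pucciSup {N : ℕ} (lam Lam : ℝ) (M : Matrix (Fin N) (Fin N) ℝ) : ℝ :=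
  sSup {t : ℝ | ∃ A : Matrix (Fin N) (Fin N) ℝ, A.IsSymm ∧
    MatLE (lam • (1 : Matrix (Fin N) (Fin N) ℝ)) A ∧
    MatLE A (Lam • (1 : Matrix (Fin N) (Fin N) ℝ)) ∧ t = (A * M).trace}

/-- Solution of the blow-up problem on the annulus `Ω \ closure Ω₀`:
`F(x,D²u) + μ u = k(x) u^p` and `u > 0` in `Ω \ closure Ω₀`, `u = 0` on `∂Ω`,
`u(x) → +∞` as `x → ∂Ω₀`. -/
def IsSolBlowUp {N : ℕ} (Ω Ω₀ : Set (Euc N)) (F : Euc N → Matrix (Fin N) (Fin N) ℝ → ℝ)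
    (μ : ℝ) (k : Euc N → ℝ) (p : ℝ) (u : Euc N → ℝ) : Prop :=
  ContinuousOn u (closure Ω \ closure Ω₀) ∧ (∀ x ∈ Ω \ closure Ω₀, 0 < u x) ∧
    ViscSubsol (Ω \ closure Ω₀) (logisticG F μ k p) u ∧
    ViscSupersol (Ω \ closure Ω₀) (logisticG F μ k p) u ∧
    (∀ x ∈ frontier Ω, u x = 0) ∧
    ∀ M : ℝ, ∃ δ : ℝ, 0 < δ ∧
      ∀ x ∈ Ω \ closure Ω₀, Metric.infDist x (frontier Ω₀) < δ → M ≤ u x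

/-- Solution of the Dirichlet problem on the annulus `Ω \ closure Ω₀` with boundary data `0`
on `∂Ω` and `φb` on `∂Ω₀`. -/
def IsSolAnnulus {N : ℕ} (Ω Ω₀ : Set (Euc N)) (F : Euc N → Matrix (Fin N) (Fin N) ℝ → ℝ)
    (μ : ℝ) (k : Euc N → ℝ) (p : ℝ) (φb : Euc N → ℝ) (u : Euc N → ℝ) : Prop :=
  ContinuousOn u (closure (Ω \ closure Ω₀)) ∧ (∀ x ∈ Ω \ closure Ω₀, 0 < u x) ∧
    ViscSubsol (Ω \ closure Ω₀) (logisticG F μ k p) u ∧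
    ViscSupersol (Ω \ closure Ω₀) (logisticG F μ k p) u ∧
    (∀ x ∈ frontier Ω, u x = 0) ∧ ∀ x ∈ frontier Ω₀, u x = φb x

section Regularization

variable {E : Type*} [NormedAddCommGroup E] [InnerProductSpace ℝ E]

/-- Expansion of the squared norm along a convex combination. -/
theorem norm_sq_convex_combination (x y : E) (t : ℝ) :
    ‖(1 - t) • x + t • y‖ ^ 2 =
      (1 - t) * ‖x‖ ^ 2 + t * ‖y‖ ^ 2 - t * (1 - t) * ‖x - y‖ ^ 2 := by
  simp only [← real_inner_self_eq_norm_sq, inner_add_left, inner_add_right, inner_sub_left,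
    inner_sub_right, real_inner_smul_left, real_inner_smul_right, real_inner_comm x y]
  ring

/-- A point minimizing `h + 3 a ‖x - ·‖²`, where `h + a ‖·‖²` is convex, is a minimum point with
quadratic growth. -/
theorem quadratic_growth_of_isMin {h : E → ℝ} {a : ℝ}
    (hconv : ∀ w w' : E, ∀ t : ℝ, 0 ≤ t → t ≤ 1 →
      h ((1 - t) • w + t • w') ≤ (1 - t) * h w + t * h w' + a * t * (1 - t) * ‖w - w'‖ ^ 2)
    {x w : E} (hw : ∀ w', h w + 3 * a * ‖x - w‖ ^ 2 ≤ h w' + 3 * a * ‖x - w'‖ ^ 2) (w' : E) :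
    h w + 3 * a * ‖x - w‖ ^ 2 + 2 * a * ‖w - w'‖ ^ 2 ≤ h w' + 3 * a * ‖x - w'‖ ^ 2 := by
  have key : ∀ t : ℝ, 0 < t → t < 1 →
      2 * a * (1 - t) * ‖w - w'‖ ^ 2 ≤
        h w' + 3 * a * ‖x - w'‖ ^ 2 - (h w + 3 * a * ‖x - w‖ ^ 2) := by
    intro t ht0 ht1
    have h1 := hw ((1 - t) • w + t • w')
    have h2 := hconv w w' t ht0.le ht1.le
    have h3 := norm_sq_convex_combination (x - w) (x - w') t
    have e1 : (1 - t) • (x - w) + t • (x - w') = x - ((1 - t) • w + t • w') := by module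
    have e2 : ‖x - w - (x - w')‖ = ‖w - w'‖ := by
      rw [show x - w - (x - w') = -(w - w') by abel, norm_neg]
    rw [e1, e2] at h3
    rw [h3] at h1
    have h4 : t * (2 * a * (1 - t) * ‖w - w'‖ ^ 2) ≤
        t * (h w' + 3 * a * ‖x - w'‖ ^ 2 - (h w + 3 * a * ‖x - w‖ ^ 2)) := by
      linarith
    exact le_of_mul_le_mul_left h4 ht0
  have hlim : Filter.Tendsto (fun t : ℝ => 2 * a * (1 - t) * ‖w - w'‖ ^ 2) (𝓝[>] 0)
      (𝓝 (2 * a * (1 - 0) * ‖w - w'‖ ^ 2)) := by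
    apply Filter.Tendsto.mono_left _ nhdsWithin_le_nhds
    exact Continuous.tendsto (by fun_prop) 0
  have := le_of_tendsto hlim (by
    filter_upwards [Ioo_mem_nhdsGT (zero_lt_one' ℝ)] with t ht using key t ht.1 ht.2)
  linarith

/-- A lower semicontinuous function bounded below by `c - a ‖· - y₀‖²` attains the minimum of its
sum with `3 a ‖x - ·‖²`. -/
theorem exists_min_add_sq [FiniteDimensional ℝ E] {h : E → ℝ} (hh : LowerSemicontinuous h)
    {a c : ℝ} (ha : 0 < a) {y₀ : E} (hc : ∀ w, c - a * ‖w - y₀‖ ^ 2 ≤ h w) (x : E) :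
    ∃ w, ∀ w', h w + 3 * a * ‖x - w‖ ^ 2 ≤ h w' + 3 * a * ‖x - w'‖ ^ 2 := by
  set b : ℝ := h x - c + 2 * a * ‖x - y₀‖ ^ 2 with hb
  have hb0 : 0 ≤ b := by
    have := hc x
    have : 0 ≤ a * ‖x - y₀‖ ^ 2 := by positivity
    linarith
  have hR : 0 ≤ b / a + 1 := by positivity
  have hlsc : LowerSemicontinuous fun w => h w + 3 * a * ‖x - w‖ ^ 2 :=
    hh.add (Continuous.lowerSemicontinuous (by fun_prop))
  obtain ⟨w, -, hw⟩ := (hlsc.lowerSemicontinuousOn (Metric.closedBall x (b / a + 1))).exists_isMinOn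
    ⟨x, Metric.mem_closedBall_self hR⟩ (isCompact_closedBall x (b / a + 1))
  refine ⟨w, fun w' => ?_⟩
  by_cases hw' : w' ∈ Metric.closedBall x (b / a + 1)
  · exact hw hw'
  · have h1 : h w + 3 * a * ‖x - w‖ ^ 2 ≤ h x + 3 * a * ‖x - x‖ ^ 2 :=
      hw (Metric.mem_closedBall_self hR)
    rw [sub_self, norm_zero] at h1
    rw [Metric.mem_closedBall, dist_comm, dist_eq_norm, not_le] at hw'
    have h2 : b ≤ a * ‖x - w'‖ ^ 2 := by
      have h3 : b / a ≤ ‖x - w'‖ ^ 2 := by nlinarith [div_nonneg hb0 ha.le]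
      rwa [div_le_iff₀' ha] at h3
    have h4 : ‖w' - y₀‖ ^ 2 ≤ 2 * ‖x - w'‖ ^ 2 + 2 * ‖x - y₀‖ ^ 2 := by
      have h5 : ‖w' - y₀‖ ≤ ‖x - w'‖ + ‖x - y₀‖ := by
        rw [norm_sub_rev x w']
        exact norm_sub_le_norm_sub_add_norm_sub _ _ _
      nlinarith [norm_nonneg (w' - y₀), sq_nonneg (‖x - w'‖ - ‖x - y₀‖)]
    have h6 := hc w'
    nlinarith

/-- Lasry–Lions regularization of a continuous function on a compact set: `f` is `C^{1,1}` with
gradient `P`, lies above the sup-convolution of `u`, and below every function obtained by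
sliding paraboloids. -/
theorem exists_lasryLions [FiniteDimensional ℝ E] {K : Set E} (hK : IsCompact K)
    (hne : K.Nonempty) {u : E → ℝ} (hu : ContinuousOn u K) {a : ℝ} (ha : 0 < a) :
    ∃ (f : E → ℝ) (P : E → E),
      (∀ x v, f (x + v) ≤ f x + inner ℝ (P x) v + 3 * a * ‖v‖ ^ 2) ∧
      (∀ x v, f x + inner ℝ (P x) v - 3 / 2 * a * ‖v‖ ^ 2 ≤ f (x + v)) ∧
      (∀ x, ∀ y ∈ K, u y - 3 / 2 * a * ‖x - y‖ ^ 2 ≤ f x) ∧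
      (∀ x w, ∃ y ∈ K, f x ≤ u y - a * ‖w - y‖ ^ 2 + 3 * a * ‖x - w‖ ^ 2) := by
  have hmax : ∀ w, ∃ y ∈ K, ∀ y' ∈ K, u y' - a * ‖w - y'‖ ^ 2 ≤ u y - a * ‖w - y‖ ^ 2 := by
    intro w
    obtain ⟨y, hy, hy'⟩ := hK.exists_isMaxOn hne
      (f := fun y => u y - a * ‖w - y‖ ^ 2) (hu.sub (by fun_prop))
    exact ⟨y, hy, fun y' h => hy' h⟩
  choose Y hYK hY using hmax
  set h : E → ℝ := fun w => u (Y w) - a * ‖w - Y w‖ ^ 2 with hh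
  have hlsc : LowerSemicontinuous h := by
    intro w c hc
    have hcont : Continuous fun w' => u (Y w) - a * ‖w' - Y w‖ ^ 2 := by fun_prop
    filter_upwards [hcont.continuousAt.eventually (lt_mem_nhds hc)] with w' hw'
    exact lt_of_lt_of_le hw' (hY w' (Y w) (hYK w))
  have hconv : ∀ w w' : E, ∀ t : ℝ, 0 ≤ t → t ≤ 1 →
      h ((1 - t) • w + t • w') ≤ (1 - t) * h w + t * h w' + a * t * (1 - t) * ‖w - w'‖ ^ 2 := by
    intro w w' t ht0 ht1
    set y := Y ((1 - t) • w + t • w') with hy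
    have h1 := hY w y (hYK _)
    have h2 := hY w' y (hYK _)
    have h3 := norm_sq_convex_combination (w - y) (w' - y) t
    have e1 : (1 - t) • (w - y) + t • (w' - y) = (1 - t) • w + t • w' - y := by module
    rw [e1, sub_sub_sub_cancel_right] at h3
    have h4 := mul_le_mul_of_nonneg_left h1 (sub_nonneg.2 ht1)
    have h5 := mul_le_mul_of_nonneg_left h2 ht0
    simp only [hh, ← hy, h3]
    linarith
  obtain ⟨y₀, hy₀⟩ := hne
  choose W hW using exists_min_add_sq hlsc ha (fun w => hY w y₀ hy₀)
  refine ⟨fun x => h (W x) + 3 * a * ‖x - W x‖ ^ 2, fun x => (6 * a) • (x - W x), ?_, ?_, ?_, ?_⟩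
  · intro x v
    have h1 := hW (x + v) (W x)
    have h2 : ‖x + v - W x‖ ^ 2 = ‖x - W x‖ ^ 2 + 2 * inner ℝ (x - W x) v + ‖v‖ ^ 2 := by
      rw [← norm_add_sq_real]; congr 2; abel
    simp only [real_inner_smul_left]
    rw [h2] at h1
    linarith
  · intro x v
    set w := W (x + v) with hw
    have h1 := quadratic_growth_of_isMin hconv (hW x) w
    have h2 : ‖x + v - w‖ ^ 2 =
        ‖x - w‖ ^ 2 + 2 * inner ℝ (x - W x) v + 2 * inner ℝ (W x - w) v + ‖v‖ ^ 2 := by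
      have : x + v - w = (x - w) + v := by abel
      rw [this, norm_add_sq_real, show x - w = (x - W x) + (W x - w) by abel, inner_add_left]
      ring
    have h3 : 0 ≤ a * ‖(2 : ℝ) • (W x - w) + (3 : ℝ) • v‖ ^ 2 := by positivity
    rw [norm_add_sq_real, norm_smul, norm_smul, real_inner_smul_left, real_inner_smul_right] at h3
    norm_num at h3
    simp only [real_inner_smul_left]
    rw [h2]
    nlinarith
  · intro x y hy
    have h1 := hY (W x) y hy
    have h2 : 0 ≤ a * ‖(2 : ℝ) • (W x - x) - (x - y)‖ ^ 2 := by positivity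
    have h3 : ‖W x - y‖ ^ 2 = ‖W x - x‖ ^ 2 + 2 * inner ℝ (W x - x) (x - y) + ‖x - y‖ ^ 2 := by
      rw [← norm_add_sq_real]; congr 2; abel
    rw [norm_sub_sq_real, norm_smul, real_inner_smul_left] at h2
    norm_num at h2
    have h4 : ‖x - W x‖ = ‖W x - x‖ := norm_sub_rev _ _
    simp only [hh, h4]
    nlinarith
  · intro x w
    exact ⟨Y w, hYK w, hW x w⟩

end Regularization

section Expansion

variable {E : Type*} [NormedAddCommGroup E] [InnerProductSpace ℝ E] {f : E → ℝ} {P : E → E}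

/-- A function lying between paraboloids of fixed opening at every point has Lipschitz gradient. -/
theorem lipschitzWith_of_paraboloids {C : ℝ} (hC : 0 < C)
    (hup : ∀ x v, f (x + v) ≤ f x + inner ℝ (P x) v + C * ‖v‖ ^ 2)
    (hlow : ∀ x v, f x + inner ℝ (P x) v - C * ‖v‖ ^ 2 ≤ f (x + v)) :
    LipschitzWith (6 * C).toNNReal P := by
  apply LipschitzWith.of_dist_le_mul
  intro x' x
  rw [Real.coe_toNNReal _ (by positivity), dist_eq_norm, dist_eq_norm]
  set D := P x' - P x with hD
  set v := (1 / (6 * C)) • D with hv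
  have h1 := hlow x' v
  have h2 := hlow x (x' - x)
  have h3 := hup x (x' - x + v)
  have e1 : x + (x' - x + v) = x' + v := by abel
  have e2 : x + (x' - x) = x' := by abel
  rw [e1, inner_add_right] at h3
  rw [e2] at h2
  have h4 : ‖x' - x + v‖ ^ 2 ≤ 2 * ‖x' - x‖ ^ 2 + 2 * ‖v‖ ^ 2 := by
    nlinarith [norm_add_le (x' - x) v, norm_nonneg (x' - x + v), sq_nonneg (‖x' - x‖ - ‖v‖)]
  have h5 : inner ℝ (P x') v - inner ℝ (P x) v = 1 / (6 * C) * ‖D‖ ^ 2 := by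
    rw [← inner_sub_left, hv, real_inner_smul_right, real_inner_self_eq_norm_sq]
  have h6 : ‖v‖ ^ 2 = (1 / (6 * C)) ^ 2 * ‖D‖ ^ 2 := by
    rw [hv, norm_smul, mul_pow, Real.norm_eq_abs, sq_abs]
  have h7 : 1 / (6 * C) * ‖D‖ ^ 2 ≤
      3 * C * ((1 / (6 * C)) ^ 2 * ‖D‖ ^ 2 + ‖x' - x‖ ^ 2) := by
    rw [← h5, ← h6]
    nlinarith
  have h8 : ‖D‖ ^ 2 ≤ (6 * C * ‖x' - x‖) ^ 2 := by
    have h9 := mul_le_mul_of_nonneg_left h7 (show 0 ≤ 12 * C by positivity)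
    have e3 : 12 * C * (1 / (6 * C) * ‖D‖ ^ 2) = 2 * ‖D‖ ^ 2 := by field_simp; ring
    have e4 : 12 * C * (3 * C * ((1 / (6 * C)) ^ 2 * ‖D‖ ^ 2 + ‖x' - x‖ ^ 2)) =
        ‖D‖ ^ 2 + (6 * C * ‖x' - x‖) ^ 2 := by field_simp; ring
    linarith
  exact (sq_le_sq₀ (norm_nonneg _) (by positivity)).1 h8

theorem hasFDerivAt_of_paraboloids {C : ℝ}
    (hup : ∀ x v, f (x + v) ≤ f x + inner ℝ (P x) v + C * ‖v‖ ^ 2)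
    (hlow : ∀ x v, f x + inner ℝ (P x) v - C * ‖v‖ ^ 2 ≤ f (x + v)) (x : E) :
    HasFDerivAt f (innerSL ℝ (P x)) x := by
  rw [hasFDerivAt_iff_isLittleO_nhds_zero]
  have h1 : (fun v => f (x + v) - f x - innerSL ℝ (P x) v) =O[𝓝 0] fun v : E => ‖v‖ ^ 2 := by
    refine Asymptotics.IsBigO.of_bound C (Filter.Eventually.of_forall fun v => ?_)
    rw [innerSL_apply_apply, Real.norm_eq_abs, norm_pow, norm_norm, abs_le]
    constructor <;> linarith [hup x v, hlow x v]
  refine h1.trans_isLittleO ?_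
  have h2 : (fun v : E => ‖v‖ ^ 2) =o[𝓝 0] fun v : E => ‖v‖ := by
    have := (Asymptotics.isLittleO_pow_pow (𝕜 := ℝ) (m := 1) (n := 2) one_lt_two).comp_tendsto
      (tendsto_norm_zero (E := E))
    simp only [pow_one] at this
    exact this
  exact h2.of_norm_right

/-- Second-order Taylor expansion at a point where the gradient is differentiable. -/
theorem eventually_abs_taylor_le {x : E} {A : E →L[ℝ] E}
    (hf : ∀ y, HasFDerivAt f (innerSL ℝ (P y)) y) (hP : HasFDerivAt P A x) {η : ℝ} (hη : 0 < η) :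
    ∀ᶠ v in 𝓝 (0 : E),
      |f (x + v) - f x - inner ℝ (P x) v - 1 / 2 * inner ℝ (A v) v| ≤ η * ‖v‖ ^ 2 := by
  rw [hasFDerivAt_iff_isLittleO_nhds_zero] at hP
  have h0 := hP.def hη
  rw [Metric.eventually_nhds_iff_ball] at h0 ⊢
  obtain ⟨ε, hε, hball⟩ := h0
  refine ⟨ε, hε, fun v hv => ?_⟩
  rw [mem_ball_zero_iff] at hv
  set ψ : ℝ → ℝ := fun t => f (x + t • v) - t * inner ℝ (P x) v - t ^ 2 / 2 * inner ℝ (A v) v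
  set ψ' : ℝ → ℝ := fun t => inner ℝ (P (x + t • v) - P x - A (t • v)) v
  have hd : ∀ t ∈ Set.Icc (0 : ℝ) 1, HasDerivWithinAt ψ (ψ' t) (Set.Icc 0 1) t := by
    intro t _
    have h1 : HasDerivAt (fun t : ℝ => x + t • v) v t := by
      simpa using ((hasDerivAt_id t).smul_const v).const_add x
    have h2 : HasDerivAt (fun t : ℝ => f (x + t • v)) (inner ℝ (P (x + t • v)) v) t := by
      have := (hf (x + t • v)).comp_hasDerivAt t h1
      rwa [innerSL_apply_apply] at this
    have h3 : HasDerivAt (fun t : ℝ => t * inner ℝ (P x) v) (inner ℝ (P x) v) t := by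
      simpa using (hasDerivAt_id t).mul_const (inner ℝ (P x) v)
    have h4 : HasDerivAt (fun t : ℝ => t ^ 2 / 2 * inner ℝ (A v) v) (t * inner ℝ (A v) v) t := by
      have := (((hasDerivAt_id t).pow 2).div_const 2).mul_const (inner ℝ (A v) v)
      simpa using this
    have h5 := ((h2.sub h3).sub h4).hasDerivWithinAt (s := Set.Icc 0 1)
    refine h5.congr_deriv ?_
    simp only [ψ', inner_sub_left, map_smul, real_inner_smul_left]
  have hb : ∀ t ∈ Set.Ico (0 : ℝ) 1, ‖ψ' t‖ ≤ η * ‖v‖ ^ 2 := by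
    intro t ht
    have hn : ‖t • v‖ ≤ ‖v‖ := by
      rw [norm_smul, Real.norm_eq_abs, abs_of_nonneg ht.1]
      exact mul_le_of_le_one_left (norm_nonneg _) ht.2.le
    have h1 := hball (t • v) (by rw [mem_ball_zero_iff]; exact hn.trans_lt hv)
    calc ‖ψ' t‖ ≤ ‖P (x + t • v) - P x - A (t • v)‖ * ‖v‖ := norm_inner_le_norm _ _
      _ ≤ η * ‖t • v‖ * ‖v‖ := by gcongr
      _ ≤ η * ‖v‖ * ‖v‖ := by gcongr
      _ = η * ‖v‖ ^ 2 := by ring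
  have := norm_image_sub_le_of_norm_deriv_le_segment_01' hd hb
  simp only [ψ, one_smul, zero_smul, add_zero, Real.norm_eq_abs] at this
  convert this using 2
  ring

end Expansion

section TheoremOnSums

/-- A Lipschitz self-map of a finite-dimensional space whose image contains a ball has a
differentiability point in any section over the ball. -/
theorem LipschitzWith.exists_differentiableAt_section {F : Type*} [NormedAddCommGroup F]
    [NormedSpace ℝ F] [FiniteDimensional ℝ F] {C : NNReal} {T : F → F} (hT : LipschitzWith C T)
    {ρ : ℝ} (hρ : 0 < ρ) {Z : F → F} (hZ : ∀ q ∈ Metric.ball (0 : F) ρ, T (Z q) = q) :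
    ∃ q ∈ Metric.ball (0 : F) ρ, DifferentiableAt ℝ T (Z q) := by
  let _ : MeasurableSpace F := borel F
  have _ : BorelSpace F := ⟨rfl⟩
  have h1 : μH[Module.finrank ℝ F] {z | ¬ DifferentiableAt ℝ T z} = 0 :=
    hT.ae_differentiableAt (μ := μH[Module.finrank ℝ F])
  have h2 : μH[Module.finrank ℝ F] (T '' {z | ¬ DifferentiableAt ℝ T z}) = 0 := by
    have h3 := hT.hausdorffMeasure_image_le (d := Module.finrank ℝ F) (by positivity)
      {z | ¬ DifferentiableAt ℝ T z}
    rw [h1, mul_zero] at h3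
    exact nonpos_iff_eq_zero.1 h3
  by_contra! hcon
  have h4 : Metric.ball (0 : F) ρ ⊆ T '' {z | ¬ DifferentiableAt ℝ T z} :=
    fun q hq => ⟨Z q, hcon q hq, hZ q hq⟩
  exact (Metric.measure_ball_pos μH[Module.finrank ℝ F] (0 : F) hρ).ne' (measure_mono_null h4 h2)

theorem le_of_forall_pos_le_add_mul {c d m : ℝ} (hm : 0 ≤ m)
    (h : ∀ ε > 0, c ≤ d + ε * m) : c ≤ d := by
  refine le_of_forall_pos_le_add fun ε hε => (h (ε / (m + 1)) (by positivity)).trans ?_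
  have : ε / (m + 1) * m ≤ ε := by
    rw [div_mul_eq_mul_div, div_le_iff₀ (by positivity)]
    nlinarith
  linarith

variable {E : Type*} [NormedAddCommGroup E] [InnerProductSpace ℝ E]

omit [InnerProductSpace ℝ E] in
theorem norm_sub_sq_le_three_mul (x y z w : E) :
    ‖x - w‖ ^ 2 ≤ 3 * (‖y - x‖ ^ 2 + ‖z - w‖ ^ 2 + ‖y - z‖ ^ 2) := by
  have h : ‖x - w‖ ≤ ‖y - x‖ + ‖y - z‖ + ‖z - w‖ := by
    calc ‖x - w‖ = ‖-(y - x) + (y - z) + (z - w)‖ := by congr 1; abel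
      _ ≤ ‖-(y - x)‖ + ‖y - z‖ + ‖z - w‖ := norm_add₃_le
      _ = _ := by rw [norm_neg]
  have h0 := norm_nonneg (x - w)
  nlinarith [sq_nonneg (‖y - x‖ - ‖y - z‖), sq_nonneg (‖y - x‖ - ‖z - w‖),
    sq_nonneg (‖y - z‖ - ‖z - w‖)]

/-- The doubled function, sup-convolved and perturbed by a linear term. -/
def doubled (u v : E → ℝ) (a : ℝ) (q₁ q₂ z₁ z₂ y₁ y₂ : E) : ℝ :=
  u y₁ + v y₂ - 3 / 2 * a * (‖z₁ - y₁‖ ^ 2 + ‖z₂ - y₂‖ ^ 2 + ‖z₁ - z₂‖ ^ 2)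
    - inner ℝ q₁ z₁ - inner ℝ q₂ z₂

theorem doubled_le_of_critical (u v : E → ℝ) {a : ℝ} (ha : 0 < a) {q₁ q₂ z₁ z₂ y₁ y₂ : E}
    (h₁ : (3 * a) • (z₁ - y₁) + (3 * a) • (z₁ - z₂) + q₁ = 0)
    (h₂ : (3 * a) • (z₂ - y₂) - (3 * a) • (z₁ - z₂) + q₂ = 0) (z₁' z₂' : E) :
    doubled u v a q₁ q₂ z₁' z₂' y₁ y₂ ≤ doubled u v a q₁ q₂ z₁ z₂ y₁ y₂ := by
  obtain ⟨s, rfl⟩ : ∃ s, z₁' = z₁ + s := ⟨z₁' - z₁, by abel⟩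
  obtain ⟨t, rfl⟩ : ∃ t, z₂' = z₂ + t := ⟨z₂' - z₂, by abel⟩
  have e₁ := congrArg (fun w => inner ℝ w s) h₁
  have e₂ := congrArg (fun w => inner ℝ w t) h₂
  simp only [inner_add_left, inner_sub_left _ ((3 * a) • (z₁ - z₂)) t, real_inner_smul_left,
    inner_zero_left] at e₁ e₂
  have n₁ : ‖z₁ + s - y₁‖ ^ 2 = ‖z₁ - y₁‖ ^ 2 + 2 * inner ℝ (z₁ - y₁) s + ‖s‖ ^ 2 := by
    rw [← norm_add_sq_real]; congr 2; abel
  have n₂ : ‖z₂ + t - y₂‖ ^ 2 = ‖z₂ - y₂‖ ^ 2 + 2 * inner ℝ (z₂ - y₂) t + ‖t‖ ^ 2 := by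
    rw [← norm_add_sq_real]; congr 2; abel
  have n₃ : ‖z₁ + s - (z₂ + t)‖ ^ 2 =
      ‖z₁ - z₂‖ ^ 2 + 2 * (inner ℝ (z₁ - z₂) s - inner ℝ (z₁ - z₂) t) + ‖s - t‖ ^ 2 := by
    rw [← inner_sub_right, ← norm_add_sq_real]; congr 2; abel
  have p : 0 ≤ a * (‖s‖ ^ 2 + ‖t‖ ^ 2 + ‖s - t‖ ^ 2) := by positivity
  simp only [doubled, n₁, n₂, n₃, inner_add_right]
  linarith

/-- Existence of a maximum point of the doubled function, with the `z`-variables given by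
the critical point equations. -/
theorem exists_max_doubled {K : Set E} (hK : IsCompact K) (hne : K.Nonempty) {u v : E → ℝ}
    (hu : ContinuousOn u K) (hv : ContinuousOn v K) {a : ℝ} (ha : 0 < a) (q₁ q₂ : E) :
    ∃ z₁ z₂, ∃ y₁ ∈ K, ∃ y₂ ∈ K,
      z₁ = (2 / 3 : ℝ) • (y₁ - (3 * a)⁻¹ • q₁) + (1 / 3 : ℝ) • (y₂ - (3 * a)⁻¹ • q₂) ∧
      z₂ = (1 / 3 : ℝ) • (y₁ - (3 * a)⁻¹ • q₁) + (2 / 3 : ℝ) • (y₂ - (3 * a)⁻¹ • q₂) ∧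
      ∀ z₁' z₂', ∀ y₁' ∈ K, ∀ y₂' ∈ K,
        doubled u v a q₁ q₂ z₁' z₂' y₁' y₂' ≤ doubled u v a q₁ q₂ z₁ z₂ y₁ y₂ := by
  set Z₁ : E × E → E := fun y =>
    (2 / 3 : ℝ) • (y.1 - (3 * a)⁻¹ • q₁) + (1 / 3 : ℝ) • (y.2 - (3 * a)⁻¹ • q₂) with hZ₁
  set Z₂ : E × E → E := fun y =>
    (1 / 3 : ℝ) • (y.1 - (3 * a)⁻¹ • q₁) + (2 / 3 : ℝ) • (y.2 - (3 * a)⁻¹ • q₂) with hZ₂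
  have hu' : ContinuousOn (fun y : E × E => u y.1) (K ×ˢ K) :=
    hu.comp continuousOn_fst fun y hy => hy.1
  have hv' : ContinuousOn (fun y : E × E => v y.2) (K ×ˢ K) :=
    hv.comp continuousOn_snd fun y hy => hy.2
  have hcont : ContinuousOn (fun y : E × E => doubled u v a q₁ q₂ (Z₁ y) (Z₂ y) y.1 y.2)
      (K ×ˢ K) := by
    simp only [doubled, hZ₁, hZ₂]
    refine (((hu'.add hv').sub ?_).sub ?_).sub ?_ <;> exact Continuous.continuousOn (by fun_prop)
  obtain ⟨y, hy, hmax⟩ := (hK.prod hK).exists_isMaxOn (hne.prod hne) hcont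
  refine ⟨Z₁ y, Z₂ y, y.1, hy.1, y.2, hy.2, rfl, rfl, fun z₁' z₂' y₁' hy₁' y₂' hy₂' => ?_⟩
  have ha' : 3 * a ≠ 0 := by positivity
  refine (doubled_le_of_critical u v ha (z₁ := Z₁ (y₁', y₂')) (z₂ := Z₂ (y₁', y₂'))
    ?_ ?_ z₁' z₂').trans (hmax (Set.mk_mem_prod hy₁' hy₂'))
  · simp only [hZ₁, hZ₂]
    match_scalars <;> field_simp <;> ring
  · simp only [hZ₁, hZ₂]
    match_scalars <;> field_simp <;> ring

/-- Linear perturbations of small size keep the maximum points of the doubled function close to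
maximal. -/
theorem nearly_max_of_max_doubled {K : Set E} {u v : E → ℝ} {a : ℝ} (ha : 0 < a)
    {q₁ q₂ z₁ z₂ y₁ y₂ : E} {R ρ : ℝ} (hR : ∀ y ∈ K, ‖y‖ ≤ R)
    (hq₁ : ‖q₁‖ ≤ ρ) (hq₂ : ‖q₂‖ ≤ ρ) (hz₁ : ‖z₁‖ ≤ R + 1) (hz₂ : ‖z₂‖ ≤ R + 1)
    (hmax : ∀ z₁' z₂', ∀ y₁' ∈ K, ∀ y₂' ∈ K,
      doubled u v a q₁ q₂ z₁' z₂' y₁' y₂' ≤ doubled u v a q₁ q₂ z₁ z₂ y₁ y₂) :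
    ∀ x' ∈ K, ∀ y' ∈ K, u x' + v y' - a / 2 * ‖x' - y'‖ ^ 2 ≤
      u y₁ + v y₂ - a / 2 * ‖y₁ - y₂‖ ^ 2 + 4 * ρ * (R + 1) := by
  intro x' hx' y' hy'
  have h := hmax ((2 / 3 : ℝ) • x' + (1 / 3 : ℝ) • y') ((1 / 3 : ℝ) • x' + (2 / 3 : ℝ) • y')
    x' hx' y' hy'
  have e₁ : (2 / 3 : ℝ) • x' + (1 / 3 : ℝ) • y' - x' = -((1 / 3 : ℝ) • (x' - y')) := by module
  have e₂ : (1 / 3 : ℝ) • x' + (2 / 3 : ℝ) • y' - y' = (1 / 3 : ℝ) • (x' - y') := by module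
  have e₃ : (2 / 3 : ℝ) • x' + (1 / 3 : ℝ) • y' - ((1 / 3 : ℝ) • x' + (2 / 3 : ℝ) • y') =
    (1 / 3 : ℝ) • (x' - y') := by module
  simp only [doubled, e₁, e₂, e₃, norm_neg, norm_smul] at h
  norm_num at h
  have h3 := norm_sub_sq_le_three_mul y₁ z₁ z₂ y₂
  have hin : ∀ q z : E, ‖q‖ ≤ ρ → ‖z‖ ≤ R + 1 → |inner ℝ q z| ≤ ρ * (R + 1) := fun q z hq hz =>
    (abs_real_inner_le_norm q z).trans
      (mul_le_mul hq hz (norm_nonneg _) ((norm_nonneg _).trans hq))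
  have hcomb : ∀ s t : ℝ, 0 ≤ s → 0 ≤ t → s + t = 1 → ‖s • x' + t • y'‖ ≤ R + 1 := by
    intro s t hs ht hst
    calc ‖s • x' + t • y'‖ ≤ ‖s • x'‖ + ‖t • y'‖ := norm_add_le _ _
      _ = s * ‖x'‖ + t * ‖y'‖ := by
        rw [norm_smul, norm_smul, Real.norm_of_nonneg hs, Real.norm_of_nonneg ht]
      _ ≤ s * R + t * R := by gcongr <;> exact hR _ ‹_›
      _ ≤ R + 1 := by rw [← add_mul, hst]; linarith
  have i₁ := (abs_le.1 (hin q₁ _ hq₁ hz₁)).1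
  have i₂ := (abs_le.1 (hin q₂ _ hq₂ hz₂)).1
  have i₃ := (abs_le.1 (hin q₁ _ hq₁ (hcomb (2 / 3) (1 / 3) (by norm_num) (by norm_num)
    (by norm_num)))).2
  have i₄ := (abs_le.1 (hin q₂ _ hq₂ (hcomb (1 / 3) (2 / 3) (by norm_num) (by norm_num)
    (by norm_num)))).2
  norm_num at i₃ i₄
  nlinarith

/-- Every function bounded by sliding paraboloids stays below the paraboloid touching the doubled
function from above. -/
theorem add_le_of_doubled_le {K : Set E} {u v f g : E → ℝ} {a : ℝ} (ha : 0 < a)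
    (hf : ∀ x w, ∃ y ∈ K, f x ≤ u y - a * ‖w - y‖ ^ 2 + 3 * a * ‖x - w‖ ^ 2)
    (hg : ∀ x w, ∃ y ∈ K, g x ≤ v y - a * ‖w - y‖ ^ 2 + 3 * a * ‖x - w‖ ^ 2)
    {q₁ q₂ : E} {M : ℝ}
    (hM : ∀ z₁ z₂, ∀ y₁ ∈ K, ∀ y₂ ∈ K, doubled u v a q₁ q₂ z₁ z₂ y₁ y₂ ≤ M) (x y : E) :
    f x + g y ≤ 3 / 2 * a * ‖x - y‖ ^ 2 + inner ℝ q₁ x + inner ℝ q₂ y + M := by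
  have point : ∀ x d : E, ∀ u' : E → ℝ, ∀ F : ℝ,
      (∀ w, ∃ y ∈ K, F ≤ u' y - a * ‖w - y‖ ^ 2 + 3 * a * ‖x - w‖ ^ 2) →
      ∃ s, ∃ y ∈ K, F ≤ u' y - 3 / 2 * a * ‖x + s - y‖ ^ 2 - inner ℝ d s - 3 * a * ‖s‖ ^ 2 := by
    intro x d u' F h
    obtain ⟨y, hy, hF⟩ := h (x - (6 * a)⁻¹ • d)
    set w := x - (6 * a)⁻¹ • d with hw
    refine ⟨y + (2 / 3 : ℝ) • (w - y) - x, y, hy, ?_⟩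
    set s := y + (2 / 3 : ℝ) • (w - y) - x with hs
    have e₁ : x + s - y = (2 / 3 : ℝ) • (w - y) := by rw [hs]; module
    have e₂ : x - w + s = -((1 / 3 : ℝ) • (w - y)) := by rw [hs]; module
    have n₁ : ‖x + s - y‖ ^ 2 = 4 / 9 * ‖w - y‖ ^ 2 := by
      rw [e₁, norm_smul, mul_pow]; norm_num
    have n₂ : ‖x - w + s‖ ^ 2 = 1 / 9 * ‖w - y‖ ^ 2 := by
      rw [e₂, norm_neg, norm_smul, mul_pow]; norm_num
    rw [norm_add_sq_real] at n₂
    have n₃ : 6 * a * inner ℝ (x - w) s = inner ℝ d s := by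
      rw [hw, sub_sub_cancel, real_inner_smul_left, mul_inv_cancel_left₀ (by positivity)]
    have n₄ : ‖x - w‖ ^ 2 = 1 / 9 * ‖w - y‖ ^ 2 - 2 * inner ℝ (x - w) s - ‖s‖ ^ 2 := by linarith
    rw [n₄] at hF
    rw [n₁]
    linarith
  obtain ⟨s, y₁, hy₁, h₁⟩ := point x ((3 * a) • (x - y) + q₁) u (f x) (hf x)
  obtain ⟨t, y₂, hy₂, h₂⟩ := point y (-((3 * a) • (x - y)) + q₂) v (g y) (hg y)
  have hm := hM (x + s) (y + t) y₁ hy₁ y₂ hy₂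
  have n₁ : ‖x + s - (y + t)‖ ^ 2 =
      ‖x - y‖ ^ 2 + 2 * (inner ℝ (x - y) s - inner ℝ (x - y) t) + ‖s - t‖ ^ 2 := by
    rw [← inner_sub_right, ← norm_add_sq_real]; congr 2; abel
  have n₂ : a * ‖s - t‖ ^ 2 ≤ a * (2 * ‖s‖ ^ 2 + 2 * ‖t‖ ^ 2) := by
    refine mul_le_mul_of_nonneg_left ?_ ha.le
    have := parallelogram_law_with_norm ℝ s t
    nlinarith [mul_self_nonneg ‖s + t‖]
  simp only [inner_add_left, inner_neg_left, real_inner_smul_left] at h₁ h₂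
  simp only [doubled, n₁, inner_add_right] at hm
  linarith

theorem gradient_eq_of_touching {f : E → ℝ} {x p p' : E} {C C' : ℝ} (hC : 0 < C + C')
    (hlow : ∀ v, f x + inner ℝ p v - C * ‖v‖ ^ 2 ≤ f (x + v))
    (hup : ∀ v, f (x + v) ≤ f x + inner ℝ p' v + C' * ‖v‖ ^ 2) : p = p' := by
  rw [← sub_eq_zero, ← norm_eq_zero]
  set D := p - p' with hD
  set t : ℝ := 1 / (2 * (C + C'))
  have ht : 0 < t := by positivity
  have h1 := (hlow (t • D)).trans (hup (t • D))
  have h2 : inner ℝ p (t • D) - inner ℝ p' (t • D) = t * ‖D‖ ^ 2 := by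
    rw [← inner_sub_left, real_inner_smul_right, real_inner_self_eq_norm_sq]
  rw [norm_smul, Real.norm_of_nonneg ht.le, mul_pow] at h1
  have h3 : (C + C') * t ^ 2 = t / 2 := by simp only [t]; field_simp
  have h4 : t * ‖D‖ ^ 2 ≤ t / 2 * ‖D‖ ^ 2 := by rw [← h3]; linarith
  have h5 : ‖D‖ ^ 2 ≤ 0 := by nlinarith
  nlinarith [norm_nonneg D, sq_nonneg ‖D‖, pow_eq_zero_iff (n := 2) (M₀ := ℝ) two_ne_zero
    |>.1 (le_antisymm h5 (sq_nonneg ‖D‖))]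

theorem tendsto_smul_nhdsGT_zero (w : E) :
    Filter.Tendsto (fun t : ℝ => t • w) (𝓝[>] 0) (𝓝 0) := by
  have : Filter.Tendsto (fun t : ℝ => t • w) (𝓝 0) (𝓝 ((0 : ℝ) • w)) :=
    Continuous.tendsto (by fun_prop) 0
  rw [zero_smul] at this
  exact this.mono_left nhdsWithin_le_nhds

/-- Second-order necessary condition: a pair of second-order expansions below a quadratic form. -/
theorem quadForm_le_of_taylor {f g : E → ℝ} {x y p q : E} {X Y : E →L[ℝ] E} {b : ℝ}
    (hf : ∀ η > 0, ∀ᶠ v in 𝓝 (0 : E),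
      |f (x + v) - f x - inner ℝ p v - 1 / 2 * inner ℝ (X v) v| ≤ η * ‖v‖ ^ 2)
    (hg : ∀ η > 0, ∀ᶠ v in 𝓝 (0 : E),
      |g (y + v) - g y - inner ℝ q v - 1 / 2 * inner ℝ (Y v) v| ≤ η * ‖v‖ ^ 2)
    (hfg : ∀ h k, f (x + h) + g (y + k) ≤
      f x + g y + inner ℝ p h + inner ℝ q k + b / 2 * ‖h - k‖ ^ 2) (h k : E) :
    inner ℝ (X h) h + inner ℝ (Y k) k ≤ b * ‖h - k‖ ^ 2 := by
  refine le_of_forall_pos_le_add_mul (m := 2 * (‖h‖ ^ 2 + ‖k‖ ^ 2)) (by positivity) fun ε hε => ?_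
  obtain ⟨t, ⟨h1, h2⟩, ht0⟩ := (((tendsto_smul_nhdsGT_zero h).eventually (hf ε hε)).and
    ((tendsto_smul_nhdsGT_zero k).eventually (hg ε hε))).and self_mem_nhdsWithin |>.exists
  have ht0 : 0 < t := ht0
  have h3 := hfg (t • h) (t • k)
  rw [← smul_sub] at h3
  simp only [map_smul, real_inner_smul_left, real_inner_smul_right, norm_smul,
    Real.norm_of_nonneg ht0.le, mul_pow] at h1 h2 h3
  have h4 := (abs_le.1 h1).1
  have h5 := (abs_le.1 h2).1
  have h6 : t ^ 2 * (inner ℝ (X h) h + inner ℝ (Y k) k) ≤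
      t ^ 2 * (b * ‖h - k‖ ^ 2 + ε * (2 * (‖h‖ ^ 2 + ‖k‖ ^ 2))) := by linarith
  exact le_of_mul_le_mul_left h6 (by positivity)

theorem le_quadForm_of_taylor {f : E → ℝ} {x p : E} {X : E →L[ℝ] E} {b : ℝ}
    (hf : ∀ η > 0, ∀ᶠ v in 𝓝 (0 : E),
      |f (x + v) - f x - inner ℝ p v - 1 / 2 * inner ℝ (X v) v| ≤ η * ‖v‖ ^ 2)
    (hlow : ∀ v, f x + inner ℝ p v - b / 2 * ‖v‖ ^ 2 ≤ f (x + v)) (h : E) :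
    -(b * ‖h‖ ^ 2) ≤ inner ℝ (X h) h := by
  refine le_of_forall_pos_le_add_mul (m := 2 * ‖h‖ ^ 2) (by positivity) fun ε hε => ?_
  obtain ⟨t, h1, ht0⟩ :=
    ((tendsto_smul_nhdsGT_zero h).eventually (hf ε hε)).and self_mem_nhdsWithin |>.exists
  have ht0 : 0 < t := ht0
  have h3 := hlow (t • h)
  simp only [map_smul, real_inner_smul_left, real_inner_smul_right, norm_smul,
    Real.norm_of_nonneg ht0.le, mul_pow] at h1 h3
  have h4 := (abs_le.1 h1).2
  have h6 : t ^ 2 * -(b * ‖h‖ ^ 2) ≤ t ^ 2 * (inner ℝ (X h) h + ε * (2 * ‖h‖ ^ 2)) := by linarith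
  exact le_of_mul_le_mul_left h6 (by positivity)

/-- A one-sided second-order expansion of the regularization at `z` transfers to `u` at the
point `y` realizing the sup-convolution. -/
theorem eventually_le_of_taylor {K : Set E} {u f : E → ℝ} {c : ℝ} {y z p : E} {X : E →L[ℝ] E}
    (hfu : ∀ x, ∀ y ∈ K, u y - c * ‖x - y‖ ^ 2 ≤ f x) (hz : f z = u y - c * ‖z - y‖ ^ 2) {η : ℝ}
    (hf : ∀ᶠ v in 𝓝 (0 : E),
      |f (z + v) - f z - inner ℝ p v - 1 / 2 * inner ℝ (X v) v| ≤ η * ‖v‖ ^ 2) :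
    ∀ᶠ y' in 𝓝 y, y' ∈ K →
      u y' ≤ u y + inner ℝ p (y' - y) + 1 / 2 * inner ℝ (X (y' - y)) (y' - y)
        + η * ‖y' - y‖ ^ 2 := by
  have ht : Filter.Tendsto (fun y' => y' - y) (𝓝 y) (𝓝 0) := by
    rw [← sub_self y]; exact Continuous.tendsto (by fun_prop) y
  filter_upwards [ht.eventually hf] with y' hy' hK
  have h1 := hfu (z + (y' - y)) y' hK
  rw [show z + (y' - y) - y' = z - y by abel] at h1
  linarith [(abs_le.1 hy').2]

/-- One-sided second-order expansions, up to the error `η`, of `u` at `x` and of `v` at `y`,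
whose Hessians satisfy the matrix inequalities of the theorem on sums with penalty `a`. -/
def DoublingJets (K : Set E) (u v : E → ℝ) (a η : ℝ) (x y : E) : Prop :=
  ∃ (p q : E) (X Y : E →L[ℝ] E),
    (∀ᶠ x' in 𝓝 x, x' ∈ K →
      u x' ≤ u x + inner ℝ p (x' - x) + 1 / 2 * inner ℝ (X (x' - x)) (x' - x)
        + η * ‖x' - x‖ ^ 2) ∧
    (∀ᶠ y' in 𝓝 y, y' ∈ K →
      v y' ≤ v y + inner ℝ q (y' - y) + 1 / 2 * inner ℝ (Y (y' - y)) (y' - y)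
        + η * ‖y' - y‖ ^ 2) ∧
    (∀ h, -(3 * a * ‖h‖ ^ 2) ≤ inner ℝ (X h) h) ∧
    (∀ h, -(3 * a * ‖h‖ ^ 2) ≤ inner ℝ (Y h) h) ∧
    ∀ h k, inner ℝ (X h) h + inner ℝ (Y k) k ≤ 3 * a * ‖h - k‖ ^ 2

/-- Theorem on sums for functions continuous on a compact set. -/
theorem exists_jets_of_doubling [FiniteDimensional ℝ E] {K : Set E} (hK : IsCompact K)
    (hne : K.Nonempty) {u v : E → ℝ} (hu : ContinuousOn u K) (hv : ContinuousOn v K)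
    {a η : ℝ} (ha : 0 < a) (hη : 0 < η) :
    ∃ x ∈ K, ∃ y ∈ K,
      (∀ x' ∈ K, ∀ y' ∈ K,
        u x' + v y' - a / 2 * ‖x' - y'‖ ^ 2 ≤ u x + v y - a / 2 * ‖x - y‖ ^ 2 + η) ∧
      DoublingJets K u v a η x y := by
  obtain ⟨f, P, hf1, hf2, hf3, hf4⟩ := exists_lasryLions hK hne hu ha
  obtain ⟨g, Q, hg1, hg2, hg3, hg4⟩ := exists_lasryLions hK hne hv ha
  have hweak : ∀ w : E, 3 / 2 * a * ‖w‖ ^ 2 ≤ 3 * a * ‖w‖ ^ 2 := fun w =>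
    mul_le_mul_of_nonneg_right (by linarith) (sq_nonneg _)
  have hf2' : ∀ x w, f x + inner ℝ (P x) w - 3 * a * ‖w‖ ^ 2 ≤ f (x + w) := fun x w => by
    linarith [hf2 x w, hweak w]
  have hg2' : ∀ x w, g x + inner ℝ (Q x) w - 3 * a * ‖w‖ ^ 2 ≤ g (x + w) := fun x w => by
    linarith [hg2 x w, hweak w]
  have h3a : 0 < 3 * a := by positivity
  obtain ⟨R, hR0, hR⟩ : ∃ R : ℝ, 0 ≤ R ∧ ∀ y ∈ K, ‖y‖ ≤ R := by
    obtain ⟨R, hR⟩ := hK.isBounded.exists_norm_le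
    exact ⟨max R 0, le_max_right _ _, fun y hy => (hR y hy).trans (le_max_left _ _)⟩
  set ρ : ℝ := min (3 * a) (η / (4 * (R + 1))) with hρ
  have hρ0 : 0 < ρ := lt_min h3a (by positivity)
  have hρη : 4 * ρ * (R + 1) ≤ η := by
    have : ρ ≤ η / (4 * (R + 1)) := min_le_right _ _
    rw [le_div_iff₀ (by positivity)] at this
    linarith
  choose Z₁ Z₂ Y₁ hY₁ Y₂ hY₂ hZ₁ hZ₂ hmax using
    fun q : E × E => exists_max_doubled hK hne hu hv ha q.1 q.2
  have hle := fun q : E × E => add_le_of_doubled_le ha hf4 hg4 (hmax q)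
  have heq : ∀ q : E × E,
      f (Z₁ q) = u (Y₁ q) - 3 / 2 * a * ‖Z₁ q - Y₁ q‖ ^ 2 ∧
      g (Z₂ q) = v (Y₂ q) - 3 / 2 * a * ‖Z₂ q - Y₂ q‖ ^ 2 := by
    intro q
    have h1 := hf3 (Z₁ q) (Y₁ q) (hY₁ q)
    have h2 := hg3 (Z₂ q) (Y₂ q) (hY₂ q)
    have h3 := hle q (Z₁ q) (Z₂ q)
    simp only [doubled] at h3
    constructor <;> linarith
  have htouch : ∀ q : E × E, ∀ h k : E, f (Z₁ q + h) + g (Z₂ q + k) ≤ f (Z₁ q) + g (Z₂ q) +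
      inner ℝ ((3 * a) • (Z₁ q - Z₂ q) + q.1) h +
      inner ℝ (-((3 * a) • (Z₁ q - Z₂ q)) + q.2) k + 3 * a / 2 * ‖h - k‖ ^ 2 := by
    intro q h k
    have h1 := hle q (Z₁ q + h) (Z₂ q + k)
    have n₁ : ‖Z₁ q + h - (Z₂ q + k)‖ ^ 2 = ‖Z₁ q - Z₂ q‖ ^ 2 +
        2 * (inner ℝ (Z₁ q - Z₂ q) h - inner ℝ (Z₁ q - Z₂ q) k) + ‖h - k‖ ^ 2 := by
      rw [← inner_sub_right, ← norm_add_sq_real]; congr 2; abel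
    rw [(heq q).1, (heq q).2]
    simp only [doubled, n₁, inner_add_right] at h1
    simp only [inner_add_left, inner_neg_left, real_inner_smul_left]
    linarith
  have hP : ∀ q : E × E, P (Z₁ q) = (3 * a) • (Z₁ q - Z₂ q) + q.1 := by
    intro q
    refine gradient_eq_of_touching (C := 3 * a) (C' := 3 * a / 2) (by positivity)
      (hf2' (Z₁ q)) fun h => ?_
    have := htouch q h 0
    simp only [add_zero, inner_zero_right, sub_zero] at this
    linarith
  have hQ : ∀ q : E × E, Q (Z₂ q) = -((3 * a) • (Z₁ q - Z₂ q)) + q.2 := by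
    intro q
    refine gradient_eq_of_touching (C := 3 * a) (C' := 3 * a / 2) (by positivity)
      (hg2' (Z₂ q)) fun k => ?_
    have := htouch q 0 k
    simp only [add_zero, inner_zero_right, zero_sub, norm_neg] at this
    linarith
  have hPlip := lipschitzWith_of_paraboloids h3a hf1 hf2'
  have hQlip := lipschitzWith_of_paraboloids h3a hg1 hg2'
  set T : E × E → E × E := fun z =>
    (P z.1 - (3 * a) • (z.1 - z.2), Q z.2 + (3 * a) • (z.1 - z.2)) with hT
  have hlin := ((3 * a) • (ContinuousLinearMap.fst ℝ E E - ContinuousLinearMap.snd ℝ E E)).lipschitz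
  have hTlip := ((hPlip.comp LipschitzWith.prod_fst).sub hlin).prodMk
    ((hQlip.comp LipschitzWith.prod_snd).add hlin)
  obtain ⟨q, hq, hdiff⟩ := LipschitzWith.exists_differentiableAt_section (T := T) hTlip hρ0
    (Z := fun q => (Z₁ q, Z₂ q)) fun q _ => by
      simp only [hT, hP, hQ]
      ext <;> simp
  have hdP : DifferentiableAt ℝ P (Z₁ q) := by
    have h1 : DifferentiableAt ℝ (fun x => (T (x, Z₂ q)).1) (Z₁ q) :=
      (hdiff.comp (f := fun x => (x, Z₂ q)) (Z₁ q) (by fun_prop)).fst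
    have h2 : P = fun x => (T (x, Z₂ q)).1 + (3 * a) • (x - Z₂ q) := by
      ext x; simp [hT]
    rw [h2]
    exact h1.add (by fun_prop)
  have hdQ : DifferentiableAt ℝ Q (Z₂ q) := by
    have h1 : DifferentiableAt ℝ (fun y => (T (Z₁ q, y)).2) (Z₂ q) :=
      (hdiff.comp (f := fun y => (Z₁ q, y)) (Z₂ q) (by fun_prop)).snd
    have h2 : Q = fun y => (T (Z₁ q, y)).2 - (3 * a) • (Z₁ q - y) := by
      ext x; simp [hT]
    rw [h2]
    exact h1.sub (by fun_prop)
  have htf := fun ε (hε : (0 : ℝ) < ε) =>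
    eventually_abs_taylor_le (hasFDerivAt_of_paraboloids hf1 hf2') hdP.hasFDerivAt hε
  have htg := fun ε (hε : (0 : ℝ) < ε) =>
    eventually_abs_taylor_le (hasFDerivAt_of_paraboloids hg1 hg2') hdQ.hasFDerivAt hε
  rw [mem_ball_zero_iff, Prod.norm_def, max_lt_iff] at hq
  have hqa : ∀ w : E, ‖w‖ < ρ → ‖(3 * a)⁻¹ • w‖ ≤ 1 := by
    intro w hw
    rw [norm_smul, norm_inv, Real.norm_of_nonneg h3a.le, inv_mul_le_iff₀ h3a, mul_one]
    exact hw.le.trans (min_le_left _ _)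
  have hcomb : ∀ s t : ℝ, 0 ≤ s → 0 ≤ t → s + t = 1 →
      ‖s • (Y₁ q - (3 * a)⁻¹ • q.1) + t • (Y₂ q - (3 * a)⁻¹ • q.2)‖ ≤ R + 1 := by
    intro s t hs ht hst
    have b₁ : ‖Y₁ q - (3 * a)⁻¹ • q.1‖ ≤ R + 1 :=
      (norm_sub_le _ _).trans (add_le_add (hR _ (hY₁ q)) (hqa _ hq.1))
    have b₂ : ‖Y₂ q - (3 * a)⁻¹ • q.2‖ ≤ R + 1 :=
      (norm_sub_le _ _).trans (add_le_add (hR _ (hY₂ q)) (hqa _ hq.2))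
    refine (norm_add_le _ _).trans ?_
    rw [norm_smul, norm_smul, Real.norm_of_nonneg hs, Real.norm_of_nonneg ht]
    calc _ ≤ s * (R + 1) + t * (R + 1) := by gcongr
      _ = R + 1 := by rw [← add_mul, hst, one_mul]
  refine ⟨Y₁ q, hY₁ q, Y₂ q, hY₂ q, ?_,
    P (Z₁ q), Q (Z₂ q), fderiv ℝ P (Z₁ q), fderiv ℝ Q (Z₂ q), eventually_le_of_taylor hf3 (heq q).1 (htf η hη),
    eventually_le_of_taylor hg3 (heq q).2 (htg η hη), ?_, ?_, ?_⟩
  · intro x' hx' y' hy'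
    refine (nearly_max_of_max_doubled ha hR hq.1.le hq.2.le ?_ ?_ (hmax q) x' hx' y' hy').trans ?_
    · rw [hZ₁ q]; exact hcomb _ _ (by norm_num) (by norm_num) (by norm_num)
    · rw [hZ₂ q]; exact hcomb _ _ (by norm_num) (by norm_num) (by norm_num)
    · linarith
  · exact le_quadForm_of_taylor htf fun w => by linarith [hf2 (Z₁ q) w]
  · exact le_quadForm_of_taylor htg fun w => by linarith [hg2 (Z₂ q) w]
  · refine quadForm_le_of_taylor htf htg fun h k => ?_
    rw [hP, hQ]
    exact htouch q h k

/-- Doubling of variables with penalty tending to infinity: the points of the theorem on sums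
concentrate at a maximum point of `u + v`. -/
theorem exists_seq_doublingJets [FiniteDimensional ℝ E] {K : Set E} (hK : IsCompact K)
    (hne : K.Nonempty) {u v : E → ℝ} (hu : ContinuousOn u K) (hv : ContinuousOn v K) :
    ∃ z ∈ K, (∀ x ∈ K, u x + v x ≤ u z + v z) ∧
      ∃ (x y : ℕ → E) (a η : ℕ → ℝ),
        (∀ n, x n ∈ K ∧ y n ∈ K ∧ 0 < a n ∧ 0 < η n ∧
          DoublingJets K u v (a n) (η n) (x n) (y n)) ∧
        Filter.Tendsto x Filter.atTop (𝓝 z) ∧ Filter.Tendsto y Filter.atTop (𝓝 z) ∧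
        Filter.Tendsto η Filter.atTop (𝓝 0) ∧
        Filter.Tendsto (fun n => a n * ‖x n - y n‖ ^ 2 + ‖x n - y n‖) Filter.atTop (𝓝 0) := by
  have hpos : ∀ n : ℕ, (0 : ℝ) < n + 1 := fun n => by positivity
  choose x hx y hy hmax hjet using fun n : ℕ =>
    exists_jets_of_doubling hK hne hu hv (hpos n) (one_div_pos.2 (hpos n))
  obtain ⟨⟨z, z'⟩, ⟨hz, hz'⟩, φ, hφ, hlim⟩ :=
    (hK.prod hK).tendsto_subseq (x := fun n => (x n, y n)) fun n => ⟨hx n, hy n⟩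
  have hxz : Filter.Tendsto (x ∘ φ) Filter.atTop (𝓝 z) := (continuous_fst.tendsto _).comp hlim
  have hyz : Filter.Tendsto (y ∘ φ) Filter.atTop (𝓝 z') := (continuous_snd.tendsto _).comp hlim
  have hη : Filter.Tendsto (fun n => 1 / ((φ n : ℝ) + 1)) Filter.atTop (𝓝 0) :=
    tendsto_one_div_add_atTop_nhds_zero_nat.comp hφ.tendsto_atTop
  have hux : Filter.Tendsto (fun n => u (x (φ n))) Filter.atTop (𝓝 (u z)) :=
    (hu z hz).tendsto.comp (tendsto_nhdsWithin_iff.2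
      ⟨hxz, Filter.Eventually.of_forall fun n => hx _⟩)
  have hvy : Filter.Tendsto (fun n => v (y (φ n))) Filter.atTop (𝓝 (v z')) :=
    (hv z' hz').tendsto.comp (tendsto_nhdsWithin_iff.2
      ⟨hyz, Filter.Eventually.of_forall fun n => hy _⟩)
  have hpen : ∀ w ∈ K, ∀ n, ((φ n : ℝ) + 1) * ‖x (φ n) - y (φ n)‖ ^ 2 ≤
      2 * (u (x (φ n)) + v (y (φ n)) - (u w + v w) + 1 / ((φ n : ℝ) + 1)) := by
    intro w hw n
    have := hmax (φ n) w hw w hw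
    rw [sub_self, norm_zero] at this
    linarith
  have hlim2 : ∀ w, Filter.Tendsto
      (fun n => 2 * (u (x (φ n)) + v (y (φ n)) - (u w + v w) + 1 / ((φ n : ℝ) + 1)))
      Filter.atTop (𝓝 (2 * (u z + v z' - (u w + v w) + 0))) := fun w =>
    (((hux.add hvy).sub_const _).add hη).const_mul 2
  have hd : Filter.Tendsto (fun n => ‖x (φ n) - y (φ n)‖) Filter.atTop (𝓝 ‖z - z'‖) :=
    (hxz.sub hyz).norm
  have hzz : z = z' := by
    have h1 := (hlim2 z).mul hη
    rw [mul_zero] at h1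
    have h2 : ‖z - z'‖ ^ 2 ≤ 0 := by
      refine le_of_tendsto_of_tendsto' (hd.pow 2) h1 fun n => ?_
      rw [mul_one_div, le_div_iff₀ (hpos _), mul_comm]
      exact hpen z hz n
    rw [← sub_eq_zero, ← norm_eq_zero]
    exact pow_eq_zero_iff two_ne_zero |>.1 (le_antisymm h2 (sq_nonneg _))
  subst hzz
  rw [sub_self, norm_zero] at hd
  have hmaxz : ∀ w ∈ K, u w + v w ≤ u z + v z := by
    intro w hw
    have : 0 ≤ 2 * (u z + v z - (u w + v w) + 0) :=
      ge_of_tendsto' (hlim2 w) fun n => le_trans (by positivity) (hpen w hw n)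
    linarith
  refine ⟨z, hz, hmaxz, x ∘ φ, y ∘ φ, fun n => (φ n : ℝ) + 1, fun n => 1 / ((φ n : ℝ) + 1),
    fun n => ⟨hx _, hy _, hpos _, one_div_pos.2 (hpos _), hjet _⟩, hxz, hyz, hη, ?_⟩
  have h3 : Filter.Tendsto (fun n => ((φ n : ℝ) + 1) * ‖x (φ n) - y (φ n)‖ ^ 2)
      Filter.atTop (𝓝 0) := by
    refine squeeze_zero (fun n => by positivity) (hpen z hz) ?_
    have := hlim2 z
    rwa [sub_self, add_zero, mul_zero] at this
  simpa using h3.add hd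

end TheoremOnSums

section TestFunctions

variable {N : ℕ}

/-- The matrix of the quadratic form `h ↦ ⟨A h, h⟩` in the standard basis. -/
def symMat (A : Euc N →L[ℝ] Euc N) : Matrix (Fin N) (Fin N) ℝ :=
  Matrix.of fun i j => 1 / 2 *
    (inner ℝ (A (EuclideanSpace.single i 1)) (EuclideanSpace.single j 1) +
      inner ℝ (A (EuclideanSpace.single j 1)) (EuclideanSpace.single i 1))

theorem symMat_isSymm (A : Euc N →L[ℝ] Euc N) : (symMat A).IsSymm := by
  ext i j
  simp [symMat, add_comm]

theorem symMat_add (A B : Euc N →L[ℝ] Euc N) : symMat (A + B) = symMat A + symMat B := by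
  ext i j
  simp only [symMat, Matrix.of_apply, Matrix.add_apply, add_apply, inner_add_left]
  ring

theorem symMat_smul (c : ℝ) (A : Euc N →L[ℝ] Euc N) : symMat (c • A) = c • symMat A := by
  ext i j
  simp only [symMat, Matrix.of_apply, Matrix.smul_apply, smul_apply, real_inner_smul_left,
    smul_eq_mul]
  ring

theorem dotProduct_symMat_mulVec (A : Euc N →L[ℝ] Euc N) (h : Fin N → ℝ) :
    h ⬝ᵥ symMat A *ᵥ h = inner ℝ (A (WithLp.toLp 2 h)) (WithLp.toLp 2 h) := by
  have e : WithLp.toLp 2 h = ∑ i, h i • EuclideanSpace.single i (1 : ℝ) := by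
    ext j
    simp [Finset.sum_apply, Pi.single_apply]
  have e' : inner ℝ (A (WithLp.toLp 2 h)) (WithLp.toLp 2 h) = ∑ i, ∑ j, h i * h j *
      inner ℝ (A (EuclideanSpace.single i 1)) (EuclideanSpace.single j 1) := by
    rw [e, map_sum, sum_inner]
    refine Finset.sum_congr rfl fun i _ => ?_
    rw [inner_sum]
    refine Finset.sum_congr rfl fun j _ => ?_
    rw [map_smul, real_inner_smul_left, real_inner_smul_right]
    ring
  have e'' : ∑ i, ∑ j, h i * h j *
      inner ℝ (A (EuclideanSpace.single j 1)) (EuclideanSpace.single i 1) = ∑ i, ∑ j, h i * h j *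
      inner ℝ (A (EuclideanSpace.single i 1)) (EuclideanSpace.single j 1) := by
    rw [Finset.sum_comm]
    simp only [mul_comm (h _) (h _)]
  rw [e']
  trans 1 / 2 * ∑ i, ∑ j, h i * h j *
      inner ℝ (A (EuclideanSpace.single i 1)) (EuclideanSpace.single j 1) + 1 / 2 *
      ∑ i, ∑ j, h i * h j *
      inner ℝ (A (EuclideanSpace.single j 1)) (EuclideanSpace.single i 1)
  · simp only [dotProduct, Matrix.mulVec, Finset.mul_sum, ← Finset.sum_add_distrib]
    refine Finset.sum_congr rfl fun i _ => Finset.sum_congr rfl fun j _ => ?_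
    simp only [symMat, Matrix.of_apply]
    ring
  · rw [e'']
    ring

theorem symMat_id : symMat (ContinuousLinearMap.id ℝ (Euc N)) = 1 := by
  ext i j
  simp only [symMat, Matrix.of_apply, ContinuousLinearMap.id_apply,
    EuclideanSpace.inner_single_left, PiLp.single_apply, Matrix.one_apply]
  by_cases h : i = j <;> simp [h, eq_comm]
  norm_num

theorem symMat_posSemidef {A : Euc N →L[ℝ] Euc N} (hA : ∀ h, 0 ≤ inner ℝ (A h) h) :
    (symMat A).PosSemidef := by
  refine Matrix.PosSemidef.of_dotProduct_mulVec_nonneg ?_ fun h => ?_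
  · exact symMat_isSymm A
  · rw [star_trivial, dotProduct_symMat_mulVec]
    exact hA _

theorem trace_symMat_rankOne (ν : Euc N) :
    (symMat ((innerSL ℝ ν).smulRight ν)).trace = ‖ν‖ ^ 2 := by
  rw [EuclideanSpace.norm_sq_eq]
  simp only [symMat, Matrix.trace, Matrix.diag, Matrix.of_apply]
  refine Finset.sum_congr rfl fun i _ => ?_
  simp only [ContinuousLinearMap.smulRight_apply, innerSL_apply_apply,
    EuclideanSpace.inner_single_right]
  simp
  ring

/-- The quadratic polynomial with gradient `p` and second-order part `A` at `x₀`. -/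
def quadPoly (c : ℝ) (p : Euc N) (A : Euc N →L[ℝ] Euc N) (x₀ x : Euc N) : ℝ :=
  c + inner ℝ p (x - x₀) + 1 / 2 * inner ℝ (A (x - x₀)) (x - x₀)

theorem contDiff_quadPoly (c : ℝ) (p : Euc N) (A : Euc N →L[ℝ] Euc N) (x₀ : Euc N) :
    ContDiff ℝ 2 (quadPoly c p A x₀) := by
  unfold quadPoly
  have h : ContDiff ℝ 2 fun x : Euc N => x - x₀ := contDiff_id.sub contDiff_const
  exact (contDiff_const.add (contDiff_const.inner ℝ h)).add
    (contDiff_const.mul ((A.contDiff.comp h).inner ℝ h))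

theorem hasFDerivAt_sub_right (x₀ x : Euc N) :
    HasFDerivAt (fun x : Euc N => x - x₀) (ContinuousLinearMap.id ℝ (Euc N)) x :=
  (hasFDerivAt_id x).sub_const x₀

theorem fderiv_quadPoly (c : ℝ) (p : Euc N) (A : Euc N →L[ℝ] Euc N) (x₀ x v : Euc N) :
    fderiv ℝ (quadPoly c p A x₀) x v =
      inner ℝ p v + 1 / 2 * (inner ℝ (A (x - x₀)) v + inner ℝ (A v) (x - x₀)) := by
  have h := hasFDerivAt_sub_right x₀ x
  have h1 := (hasFDerivAt_const p x).inner ℝ h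
  have h2 := ((A.hasFDerivAt (x := x - x₀)).comp x h).inner ℝ h
  have h3 := ((hasFDerivAt_const c x).add h1).add (h2.const_mul (1 / 2))
  have h4 : HasFDerivAt (quadPoly c p A x₀) _ x := h3
  rw [h4.fderiv]
  simp [fderivInnerCLM_apply]

theorem hessianMatrix_quadPoly (c : ℝ) (p : Euc N) (A : Euc N →L[ℝ] Euc N) (x₀ x : Euc N) :
    hessianMatrix (quadPoly c p A x₀) x = symMat A := by
  ext i j
  simp only [hessianMatrix, symMat, Matrix.of_apply, iteratedFDeriv_two_apply,
    Matrix.cons_val_zero, Matrix.cons_val_one]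
  generalize EuclideanSpace.single i (1 : ℝ) = w
  generalize EuclideanSpace.single j (1 : ℝ) = v
  have hd : DifferentiableAt ℝ (fderiv ℝ (quadPoly c p A x₀)) x :=
    ((contDiff_quadPoly c p A x₀).fderiv_right (m := 1) (by norm_num)).differentiable
      (by norm_num) x
  have h0 := hd.hasFDerivAt.clm_apply (hasFDerivAt_const v x)
  have e : (fun y => fderiv ℝ (quadPoly c p A x₀) y v) = fun y =>
      inner ℝ p v + 1 / 2 * (inner ℝ (A (y - x₀)) v + inner ℝ (A v) (y - x₀)) := by
    ext y
    exact fderiv_quadPoly c p A x₀ y v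
  rw [e] at h0
  have h := hasFDerivAt_sub_right x₀ x
  have h1 := ((A.hasFDerivAt (x := x - x₀)).comp x h).inner ℝ (hasFDerivAt_const v x)
  have h2 := (hasFDerivAt_const (A v) x).inner ℝ h
  have h3 : HasFDerivAt (fun y =>
      inner ℝ p v + 1 / 2 * (inner ℝ (A (y - x₀)) v + inner ℝ (A v) (y - x₀))) _ x :=
    ((h1.add h2).const_mul (1 / 2)).const_add (inner ℝ p v)
  have h4 := congrArg (fun L : Euc N →L[ℝ] ℝ => L w) (h0.unique h3)
  simpa [fderivInnerCLM_apply, mul_add] using h4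

theorem ViscSubsol.nonneg_of_jet {Ω : Set (Euc N)}
    {G : Euc N → ℝ → Matrix (Fin N) (Fin N) ℝ → ℝ} {u : Euc N → ℝ} (hu : ViscSubsol Ω G u)
    {x₀ p : Euc N} {A : Euc N →L[ℝ] Euc N} (hx₀ : x₀ ∈ Ω)
    (h : ∀ᶠ x in 𝓝 x₀, u x ≤ quadPoly (u x₀) p A x₀ x) : 0 ≤ G x₀ (u x₀) (symMat A) := by
  rw [← hessianMatrix_quadPoly (u x₀) p A x₀ x₀]
  have e : quadPoly (u x₀) p A x₀ x₀ = u x₀ := by simp [quadPoly]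
  refine hu x₀ hx₀ _ (contDiff_quadPoly _ p A x₀) e.symm
    (Filter.Eventually.filter_mono nhdsWithin_le_nhds (h.mono fun x hx => ?_))
  dsimp only
  rw [e]
  linarith

theorem ViscSupersol.nonpos_of_jet {Ω : Set (Euc N)}
    {G : Euc N → ℝ → Matrix (Fin N) (Fin N) ℝ → ℝ} {u : Euc N → ℝ} (hu : ViscSupersol Ω G u)
    {x₀ p : Euc N} {A : Euc N →L[ℝ] Euc N} (hx₀ : x₀ ∈ Ω)
    (h : ∀ᶠ x in 𝓝 x₀, quadPoly (u x₀) p A x₀ x ≤ u x) : G x₀ (u x₀) (symMat A) ≤ 0 := by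
  rw [← hessianMatrix_quadPoly (u x₀) p A x₀ x₀]
  have e : quadPoly (u x₀) p A x₀ x₀ = u x₀ := by simp [quadPoly]
  refine hu x₀ hx₀ _ (contDiff_quadPoly _ p A x₀) e.symm
    (Filter.Eventually.filter_mono nhdsWithin_le_nhds (h.mono fun x hx => ?_))
  dsimp only
  rw [e]
  linarith

/-- The structure condition applied to the second-order parts produced by the doubling of
variables. -/
theorem matLE_fromBlocks_symMat {a : ℝ} {X Y : Euc N →L[ℝ] Euc N}
    (hX : ∀ h, -(3 * a * ‖h‖ ^ 2) ≤ inner ℝ (X h) h)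
    (hY : ∀ h, -(3 * a * ‖h‖ ^ 2) ≤ inner ℝ (Y h) h)
    (hXY : ∀ h k, inner ℝ (X h) h + inner ℝ (Y k) k ≤ 3 * a * ‖h - k‖ ^ 2) :
    MatLE ((-(3 * a)) • (1 : Matrix (Fin N ⊕ Fin N) (Fin N ⊕ Fin N) ℝ))
        (Matrix.fromBlocks (symMat X) 0 0 (symMat Y)) ∧
      MatLE (Matrix.fromBlocks (symMat X) 0 0 (symMat Y))
        ((3 * a) • Matrix.fromBlocks 1 (-1) (-1) 1) := by
  have hs : (Matrix.fromBlocks (symMat X) 0 0 (symMat Y)).IsHermitian :=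
    Matrix.IsSymm.fromBlocks (symMat_isSymm X) (by simp) (symMat_isSymm Y)
  have h1 : (Matrix.fromBlocks 1 (-1) (-1) 1 :
      Matrix (Fin N ⊕ Fin N) (Fin N ⊕ Fin N) ℝ).IsHermitian :=
    Matrix.IsSymm.fromBlocks (by simp [Matrix.IsSymm]) (by simp) (by simp [Matrix.IsSymm])
  have hq : ∀ v : Fin N ⊕ Fin N → ℝ, v ⬝ᵥ Matrix.fromBlocks (symMat X) 0 0 (symMat Y) *ᵥ v =
      inner ℝ (X (WithLp.toLp 2 (v ∘ Sum.inl))) (WithLp.toLp 2 (v ∘ Sum.inl)) +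
        inner ℝ (Y (WithLp.toLp 2 (v ∘ Sum.inr))) (WithLp.toLp 2 (v ∘ Sum.inr)) := by
    intro v
    rw [← dotProduct_symMat_mulVec, ← dotProduct_symMat_mulVec]
    simp [Matrix.fromBlocks_mulVec, dotProduct]
  refine ⟨Matrix.PosSemidef.of_dotProduct_mulVec_nonneg
    (hs.sub (by simp [Matrix.IsHermitian])) fun v => ?_,
    Matrix.PosSemidef.of_dotProduct_mulVec_nonneg
    ((h1.smul (IsSelfAdjoint.all _)).sub hs) fun v => ?_⟩
  · have hl := hX (WithLp.toLp 2 (v ∘ Sum.inl))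
    have hr := hY (WithLp.toLp 2 (v ∘ Sum.inr))
    have e : v ⬝ᵥ v = ‖(WithLp.toLp 2 (v ∘ Sum.inl) : Euc N)‖ ^ 2 +
        ‖(WithLp.toLp 2 (v ∘ Sum.inr) : Euc N)‖ ^ 2 := by
      rw [EuclideanSpace.norm_sq_eq, EuclideanSpace.norm_sq_eq]
      simp [dotProduct, ← sq]
    rw [star_trivial, Matrix.sub_mulVec, dotProduct_sub, hq, Matrix.smul_mulVec,
      Matrix.one_mulVec, dotProduct_smul, e, smul_eq_mul]
    linarith
  · have hlr := hXY (WithLp.toLp 2 (v ∘ Sum.inl)) (WithLp.toLp 2 (v ∘ Sum.inr))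
    have e : v ⬝ᵥ (Matrix.fromBlocks 1 (-1) (-1) 1 : Matrix (Fin N ⊕ Fin N) (Fin N ⊕ Fin N) ℝ) *ᵥ v
        = ‖(WithLp.toLp 2 (v ∘ Sum.inl) : Euc N) - WithLp.toLp 2 (v ∘ Sum.inr)‖ ^ 2 := by
      simp only [Matrix.fromBlocks_mulVec, EuclideanSpace.norm_sq_eq, dotProduct,
        Fintype.sum_sum_type, ← Finset.sum_add_distrib]
      refine Finset.sum_congr rfl fun i _ => ?_
      simp [Matrix.neg_mulVec]
      ring
    rw [star_trivial, Matrix.sub_mulVec, dotProduct_sub, hq, Matrix.smul_mulVec,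
      dotProduct_smul, e, smul_eq_mul]
    linarith

end TestFunctions
section Hopf

variable {N : ℕ}

theorem rpow_sub_rpow_le {p s t M : ℝ} (hp : 1 < p) (hs : 0 ≤ s) (hst : s ≤ t) (htM : t ≤ M) :
    t ^ p - s ^ p ≤ p * M ^ (p - 1) * (t - s) := by
  rcases (hs.trans hst).eq_or_lt with h0 | h0
  · have : s = 0 := le_antisymm (h0 ▸ hst) hs
    simp [← h0, this]
  have hd : -1 ≤ s / t - 1 := by
    have : 0 ≤ s / t := by positivity
    linarith
  have h1 := one_add_mul_self_le_rpow_one_add hd hp.le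
  rw [add_sub_cancel, Real.div_rpow hs h0.le, le_div_iff₀ (by positivity)] at h1
  have e : t ^ p = t ^ (p - 1) * t := by
    rw [Real.rpow_sub_one h0.ne']
    field_simp
  have h2 : t ^ p - s ^ p ≤ p * t ^ (p - 1) * (t - s) := by
    have : (1 + p * (s / t - 1)) * t ^ p = t ^ p - p * t ^ (p - 1) * (t - s) := by
      rw [e]
      field_simp
      ring
    linarith
  refine h2.trans (mul_le_mul_of_nonneg_right ?_ (by linarith))
  exact mul_le_mul_of_nonneg_left (Real.rpow_le_rpow h0.le htM (by linarith)) (by linarith)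

/-- The (constant) Hessian `2 L ν ⊗ ν - 2 θ I` of the barrier function. -/
def barrierHessian (ν : Euc N) (L θ : ℝ) : Euc N →L[ℝ] Euc N :=
  (2 * L) • (innerSL ℝ ν).smulRight ν - (2 * θ) • ContinuousLinearMap.id ℝ (Euc N)

theorem inner_barrierHessian (ν v w : Euc N) (L θ : ℝ) :
    inner ℝ (barrierHessian ν L θ v) w =
      2 * L * (inner ℝ ν v * inner ℝ ν w) - 2 * θ * inner ℝ v w := by
  simp [barrierHessian, inner_sub_left, real_inner_smul_left]

/-- The function `x ↦ ⟨ν, x - x₀⟩ + L ⟨ν, x - x₀⟩² - θ |x - x₀|²`. -/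
def barrier (ν : Euc N) (L θ : ℝ) (x₀ x : Euc N) : ℝ :=
  inner ℝ ν (x - x₀) + L * inner ℝ ν (x - x₀) ^ 2 - θ * ‖x - x₀‖ ^ 2

theorem continuous_barrier (ν : Euc N) (L θ : ℝ) (x₀ : Euc N) :
    Continuous (barrier ν L θ x₀) := by
  unfold barrier
  fun_prop

theorem barrier_expansion (ν : Euc N) (L θ : ℝ) (x₀ x y : Euc N) :
    barrier ν L θ x₀ y = barrier ν L θ x₀ x +
      inner ℝ (ν + barrierHessian ν L θ (x - x₀)) (y - x) +
      1 / 2 * inner ℝ (barrierHessian ν L θ (y - x)) (y - x) := by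
  have e : y - x₀ = (x - x₀) + (y - x) := by abel
  rw [inner_add_left, inner_barrierHessian, inner_barrierHessian, real_inner_self_eq_norm_sq]
  unfold barrier
  rw [e, inner_add_right, norm_add_sq_real]
  ring

theorem symMat_neg (A : Euc N →L[ℝ] Euc N) : symMat (-A) = -symMat A := by
  rw [← neg_one_smul ℝ A, symMat_smul, neg_one_smul]

theorem IsF1.sub_le_of_barrier {Ω : Set (Euc N)} {F : Euc N → Matrix (Fin N) (Fin N) ℝ → ℝ}
    {lam Lam : ℝ} (hF : IsF1 Ω F lam Lam) {x y ν : Euc N} (hx : x ∈ Ω) (hy : y ∈ Ω)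
    (hν : ‖ν‖ = 1) {η s L θ : ℝ} (hη : 0 ≤ η) (hs : 0 ≤ s) (hL : 0 ≤ L) (hθ : 0 ≤ θ)
    (X Y : Euc N →L[ℝ] Euc N) :
    F x (symMat (X + (2 * η) • ContinuousLinearMap.id ℝ (Euc N) - s • barrierHessian ν L θ)) -
        F y (symMat (-(Y + (2 * η) • ContinuousLinearMap.id ℝ (Euc N)))) ≤
      F x (symMat X) - F y (-symMat Y) + 4 * η * Lam * N -
        s * (2 * L * lam - 2 * θ * N * Lam) := by
  obtain ⟨-, -, h⟩ := hF
  set S := symMat ((innerSL ℝ ν).smulRight ν) with hS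
  have hSpos : S.PosSemidef := symMat_posSemidef fun v => by
    simpa [real_inner_smul_left] using mul_self_nonneg (inner ℝ ν v)
  have hStr : S.trace = 1 := by rw [hS, trace_symMat_rankOne, hν, one_pow]
  have hone : ∀ c : ℝ, 0 ≤ c → (c • (1 : Matrix (Fin N) (Fin N) ℝ)).PosSemidef := fun c hc =>
    Matrix.PosSemidef.one.smul hc
  have htr : ∀ c : ℝ, (c • (1 : Matrix (Fin N) (Fin N) ℝ)).trace = c * N := fun c => by
    simp [Matrix.trace_smul]
  have hsymm : (symMat X - (2 * s * L) • S).IsSymm :=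
    (symMat_isSymm X).sub ((symMat_isSymm _).smul _)
  have h1 := (h x hx _ _ hsymm (hSpos.smul (by positivity : 0 ≤ 2 * s * L))).1
  have h2 := (h x hx _ _ hsymm (hone (2 * η + 2 * s * θ) (by positivity))).2
  have h3 := (h y hy (symMat (-(Y + (2 * η) • ContinuousLinearMap.id ℝ (Euc N)))) _
    (symMat_isSymm _) (hone (2 * η) (by positivity))).2
  have e1 : symMat X - (2 * s * L) • S + (2 * s * L) • S = symMat X := sub_add_cancel _ _
  have e2 : symMat X - (2 * s * L) • S + (2 * η + 2 * s * θ) • (1 : Matrix (Fin N) (Fin N) ℝ) =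
      symMat (X + (2 * η) • ContinuousLinearMap.id ℝ (Euc N) - s • barrierHessian ν L θ) := by
    rw [barrierHessian, sub_eq_add_neg (X + _), sub_eq_add_neg ((2 * L) • _), symMat_add,
      symMat_add, symMat_neg, symMat_smul, symMat_smul, symMat_add, symMat_neg, symMat_smul,
      symMat_smul, symMat_id, ← hS]
    module
  have e3 : symMat (-(Y + (2 * η) • ContinuousLinearMap.id ℝ (Euc N))) +
      (2 * η) • (1 : Matrix (Fin N) (Fin N) ℝ) = -symMat Y := by
    rw [symMat_neg, symMat_add, symMat_smul, symMat_id]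
    module
  rw [e1, Matrix.trace_smul, hStr, smul_eq_mul] at h1
  rw [e2, htr] at h2
  rw [e3, htr] at h3
  linarith

theorem ViscSubsol.nonneg_of_jet_add_barrier {Ω K : Set (Euc N)}
    {G : Euc N → ℝ → Matrix (Fin N) (Fin N) ℝ → ℝ} {u : Euc N → ℝ} (hu : ViscSubsol Ω G u)
    {x q ν x₀ : Euc N} {X : Euc N →L[ℝ] Euc N} {η s L θ : ℝ} (hx : x ∈ Ω) (hK : K ∈ 𝓝 x)
    (h : ∀ᶠ x' in 𝓝 x, x' ∈ K → u x' + s * barrier ν L θ x₀ x' ≤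
      u x + s * barrier ν L θ x₀ x + inner ℝ q (x' - x) +
        1 / 2 * inner ℝ (X (x' - x)) (x' - x) + η * ‖x' - x‖ ^ 2) :
    0 ≤ G x (u x) (symMat (X + (2 * η) • ContinuousLinearMap.id ℝ (Euc N) -
      s • barrierHessian ν L θ)) := by
  refine hu.nonneg_of_jet (p := q - s • (ν + barrierHessian ν L θ (x - x₀))) hx ?_
  filter_upwards [h, hK] with x' hx' hxK
  have h1 := hx' hxK
  rw [barrier_expansion ν L θ x₀ x x'] at h1
  rw [quadPoly]
  generalize x' - x = d at h1 ⊢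
  simp only [sub_apply, add_apply, smul_apply, ContinuousLinearMap.id_apply,
    inner_sub_left, inner_add_left, real_inner_smul_left, real_inner_self_eq_norm_sq] at h1 ⊢
  linarith

theorem ViscSupersol.nonpos_of_jet_neg {Ω K : Set (Euc N)}
    {G : Euc N → ℝ → Matrix (Fin N) (Fin N) ℝ → ℝ} {u : Euc N → ℝ} (hu : ViscSupersol Ω G u)
    {y q : Euc N} {Y : Euc N →L[ℝ] Euc N} {η : ℝ} (hy : y ∈ Ω) (hK : K ∈ 𝓝 y)
    (h : ∀ᶠ y' in 𝓝 y, y' ∈ K → -u y' ≤ -u y + inner ℝ q (y' - y) +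
        1 / 2 * inner ℝ (Y (y' - y)) (y' - y) + η * ‖y' - y‖ ^ 2) :
    G y (u y) (symMat (-(Y + (2 * η) • ContinuousLinearMap.id ℝ (Euc N)))) ≤ 0 := by
  refine hu.nonpos_of_jet (p := -q) hy ?_
  filter_upwards [h, hK] with y' hy' hyK
  have h1 := hy' hyK
  simp only [quadPoly, neg_apply, add_apply, smul_apply, ContinuousLinearMap.id_apply,
    inner_neg_left, inner_add_left, real_inner_smul_left, real_inner_self_eq_norm_sq] at h1 ⊢
  linarith

/-- At an interior maximum of the perturbed difference `u₂ + s * barrier - u₁`, the zeroth-order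
terms have to compensate for the strict ellipticity gained from the barrier. -/
theorem exists_max_zeroth_order_le {Ω K : Set (Euc N)}
    {F : Euc N → Matrix (Fin N) (Fin N) ℝ → ℝ} {lam Lam p μ : ℝ} {k u₁ u₂ : Euc N → ℝ}
    (hΩ : IsOpen Ω) (hF1 : IsF1 Ω F lam Lam) (hF3 : IsF3 Ω F) (hp : 0 < p)
    (hk : ContinuousOn k Ω) (hu₁ : ContinuousOn u₁ Ω) (hu₂ : ContinuousOn u₂ Ω)
    (hsuper : ViscSupersol Ω (logisticG F μ k p) u₁)
    (hsub : ViscSubsol Ω (logisticG F μ k p) u₂)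
    (hK : IsCompact K) (hne : K.Nonempty) (hKΩ : K ⊆ Ω)
    {ν x₀ : Euc N} (hν : ‖ν‖ = 1) {s L θ : ℝ} (hs : 0 ≤ s) (hL : 0 ≤ L) (hθ : 0 ≤ θ)
    (hinterior : ∀ z ∈ K, (∀ x ∈ K, u₂ x + s * barrier ν L θ x₀ x - u₁ x ≤
      u₂ z + s * barrier ν L θ x₀ z - u₁ z) → K ∈ 𝓝 z) :
    ∃ z ∈ K, (∀ x ∈ K, u₂ x + s * barrier ν L θ x₀ x - u₁ x ≤
        u₂ z + s * barrier ν L θ x₀ z - u₁ z) ∧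
      s * (2 * L * lam - 2 * θ * N * Lam) ≤
        μ * u₂ z - k z * u₂ z ^ p - (μ * u₁ z - k z * u₁ z ^ p) := by
  obtain ⟨ω, -, hω0, hωc, -, hω⟩ := hF3
  obtain ⟨z, hz, hzmax, x, y, a, η, hxy, hx, hy, hη, hd⟩ :=
    exists_seq_doublingJets (u := fun x => u₂ x + s * barrier ν L θ x₀ x) (v := fun x => -u₁ x)
      hK hne ((hu₂.mono hKΩ).add ((continuous_barrier ν L θ x₀).const_mul s).continuousOn)
      (hu₁.mono hKΩ).neg
  have hzmax' : ∀ x ∈ K, u₂ x + s * barrier ν L θ x₀ x - u₁ x ≤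
      u₂ z + s * barrier ν L θ x₀ z - u₁ z := fun x hx => by
    simpa only [sub_eq_add_neg] using hzmax x hx
  have hKz : K ∈ 𝓝 z := hinterior z hz hzmax'
  refine ⟨z, hz, hzmax', ?_⟩
  have hΩz : Ω ∈ 𝓝 z := hΩ.mem_nhds (hKΩ hz)
  have hg : ∀ u : Euc N → ℝ, ContinuousOn u Ω →
      ContinuousAt (fun x => μ * u x - k x * u x ^ p) z := fun u hu =>
    ((hu.continuousAt hΩz).const_mul μ).sub
      ((hk.continuousAt hΩz).mul ((hu.continuousAt hΩz).rpow_const (Or.inr hp.le)))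
  have hlim := (((hωc.tendsto.comp hd).add ((hη.const_mul 4).mul_const (Lam * N))).add
    ((hg u₂ hu₂).tendsto.comp hx)).sub ((hg u₁ hu₁).tendsto.comp hy)
  rw [hω0, mul_zero, zero_mul, zero_add, zero_add] at hlim
  refine ge_of_tendsto hlim ?_
  filter_upwards [hx.eventually (eventually_mem_nhds_iff.2 hKz),
    hy.eventually (eventually_mem_nhds_iff.2 hKz)] with n hxn hyn
  obtain ⟨hxK, hyK, han, hηn, q₁, q₂, X, Y, hX, hY, hX', hY', hXY⟩ := hxy n
  have h1 := hsub.nonneg_of_jet_add_barrier (hKΩ hxK) hxn hX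
  have h2 := hsuper.nonpos_of_jet_neg (hKΩ hyK) hyn hY
  have h3 := hF1.sub_le_of_barrier (hKΩ hxK) (hKΩ hyK) hν hηn.le hs hL hθ X Y
  obtain ⟨h4, h5⟩ := matLE_fromBlocks_symMat hX' hY' hXY
  have h6 := hω (a n) han (x n) (hKΩ hxK) (y n) (hKΩ hyK) (symMat X) (-symMat Y)
    (symMat_isSymm X) (symMat_isSymm Y).neg (by rwa [neg_neg]) (by rwa [neg_neg])
  simp only [logisticG, Real.rpow_eq_pow] at h1 h2
  simp only [Function.comp_apply]
  linarith

theorem barrier_le {ν x₀ x : Euc N} (hν : ‖ν‖ = 1) {L θ r : ℝ} (hL : 0 ≤ L) (hθ : 0 ≤ θ)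
    (hLr : L * r ≤ 1) (hx : ‖x - x₀‖ ≤ r) : barrier ν L θ x₀ x ≤ 2 * r := by
  have h1 : |inner ℝ ν (x - x₀)| ≤ r :=
    (abs_real_inner_le_norm _ _).trans (by rw [hν, one_mul]; exact hx)
  have h2 : inner ℝ ν (x - x₀) ^ 2 ≤ r * r := by
    rw [← sq_abs, sq]
    exact mul_self_le_mul_self (abs_nonneg _) h1
  have hr : 0 ≤ r := (norm_nonneg _).trans hx
  have h3 : 0 ≤ θ * ‖x - x₀‖ ^ 2 := by positivity
  have h4 := mul_le_mul_of_nonneg_left h2 hL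
  have h5 := mul_le_mul_of_nonneg_right hLr hr
  unfold barrier
  linarith [le_abs_self (inner ℝ ν (x - x₀))]

theorem norm_sub_lt_of_barrier_nonneg {ν x₀ y₀ x : Euc N} {L R : ℝ} (hν : ‖ν‖ = 1) (hR : 0 < R)
    (hy₀ : y₀ - x₀ = R • ν) (hL : 0 ≤ L) (hLx : L * ‖x - x₀‖ < 1) (hne : x ≠ x₀)
    (h : 0 ≤ barrier ν L R⁻¹ x₀ x) : ‖x - y₀‖ < R := by
  have h1 : |inner ℝ ν (x - x₀)| ≤ ‖x - x₀‖ := by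
    simpa [hν] using abs_real_inner_le_norm ν (x - x₀)
  have hpos : 0 < ‖x - x₀‖ ^ 2 := by
    have := norm_pos_iff.2 (sub_ne_zero.2 hne)
    positivity
  have e : ‖x - y₀‖ ^ 2 = ‖x - x₀‖ ^ 2 - 2 * R * inner ℝ ν (x - x₀) + R ^ 2 := by
    have : x - y₀ = (x - x₀) - R • ν := by rw [← hy₀]; abel
    rw [this, norm_sub_sq_real, real_inner_smul_right, norm_smul, hν, mul_one,
      Real.norm_eq_abs, sq_abs, real_inner_comm]
    ring
  unfold barrier at h
  generalize inner ℝ ν (x - x₀) = t at *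
  have h2 : |L * t| < 1 := by
    rw [abs_mul, abs_of_nonneg hL]
    exact (mul_le_mul_of_nonneg_left h1 hL).trans_lt hLx
  obtain ⟨h3, h4⟩ := abs_lt.1 h2
  have h5 : ‖x - x₀‖ ^ 2 ≤ R * (t * (1 + L * t)) := by
    have := mul_le_mul_of_nonneg_left h hR.le
    have e' : R * (t + L * t ^ 2 - R⁻¹ * ‖x - x₀‖ ^ 2) =
      R * (t * (1 + L * t)) - ‖x - x₀‖ ^ 2 := by
      field_simp
    rw [e'] at this
    linarith
  have ht : 0 < t := by
    by_contra! hcon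
    have : t * (1 + L * t) ≤ 0 := mul_nonpos_of_nonpos_of_nonneg hcon (by linarith)
    have := mul_nonpos_of_nonneg_of_nonpos hR.le this
    linarith
  have h6 : R * (t * (1 + L * t)) < R * (t * 2) :=
    mul_lt_mul_of_pos_left (mul_lt_mul_of_pos_left (by linarith) ht) hR
  refine lt_of_pow_lt_pow_left₀ 2 hR.le ?_
  rw [e]
  linarith

theorem exists_pos_mul_lt_of_isCompact {X : Type*} [TopologicalSpace X] {S : Set X}
    (hS : IsCompact S) {b w : X → ℝ} (hb : Continuous b) (hw : ContinuousOn w S)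
    (hw0 : ∀ x ∈ S, 0 ≤ w x) (hpos : ∀ x ∈ S, 0 ≤ b x → 0 < w x) :
    ∃ s, 0 < s ∧ ∀ x ∈ S, s * b x < w x := by
  have hc : IsCompact (S ∩ {x | 0 ≤ b x}) := hS.inter_right (isClosed_le continuous_const hb)
  rcases (S ∩ {x | 0 ≤ b x}).eq_empty_or_nonempty with he | hne
  · refine ⟨1, one_pos, fun x hx => ?_⟩
    have hbx : b x < 0 := by
      by_contra! h
      exact (he ▸ (⟨hx, h⟩ : x ∈ S ∩ {x | 0 ≤ b x}) : x ∈ (∅ : Set X))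
    linarith [hw0 x hx]
  · obtain ⟨z, hz, hzmin⟩ := hc.exists_isMinOn hne (hw.mono Set.inter_subset_left)
    obtain ⟨y, hy, hymax⟩ := hc.exists_isMaxOn hne hb.continuousOn
    have hwz := hpos z hz.1 hz.2
    have hby : 0 ≤ b y := hy.2
    refine ⟨w z / (b y + 1), by positivity, fun x hx => ?_⟩
    by_cases h : 0 ≤ b x
    · have h1 : w z ≤ w x := hzmin ⟨hx, h⟩
      have h2 : b x ≤ b y := hymax ⟨hx, h⟩
      rw [div_mul_eq_mul_div, div_lt_iff₀ (by linarith)]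
      have h3 : w z * b x < w z * (b y + 1) := mul_lt_mul_of_pos_left (by linarith) hwz
      have h4 := mul_le_mul_of_nonneg_right h1 (by linarith : 0 ≤ b y + 1)
      linarith
    · have h1 : w z / (b y + 1) * b x < 0 :=
        mul_neg_of_pos_of_neg (by positivity) (not_le.1 h)
      linarith [hw0 x hx]

/-- The contact set of an ordered sub- and supersolution cannot be touched from outside by a
ball. -/
theorem not_forall_lt_of_contact {Ω : Set (Euc N)}
    {F : Euc N → Matrix (Fin N) (Fin N) ℝ → ℝ} {lam Lam p μ : ℝ} {k u₁ u₂ : Euc N → ℝ}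
    (hΩ : IsOpen Ω) (hF1 : IsF1 Ω F lam Lam) (hF3 : IsF3 Ω F) (hp : 1 < p)
    (hk : ContinuousOn k Ω) (hk0 : ∀ x ∈ Ω, 0 ≤ k x)
    (hu₁ : ContinuousOn u₁ Ω) (hu₂ : ContinuousOn u₂ Ω) (hu₂0 : ∀ x ∈ Ω, 0 ≤ u₂ x)
    (hsuper : ViscSupersol Ω (logisticG F μ k p) u₁)
    (hsub : ViscSubsol Ω (logisticG F μ k p) u₂) (hle : ∀ x ∈ Ω, u₂ x ≤ u₁ x)
    {x₀ y₀ : Euc N} (hx₀ : x₀ ∈ Ω) (heq : u₁ x₀ = u₂ x₀) (hne : y₀ ≠ x₀) :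
    ¬ ∀ x ∈ Ω, ‖x - y₀‖ < ‖y₀ - x₀‖ → u₂ x < u₁ x := by
  intro hlt
  set R := ‖y₀ - x₀‖ with hRdef
  have hR : 0 < R := norm_pos_iff.2 (sub_ne_zero.2 hne)
  set ν := R⁻¹ • (y₀ - x₀) with hνdef
  have hν : ‖ν‖ = 1 := by
    rw [hνdef, norm_smul, norm_inv, Real.norm_of_nonneg hR.le, ← hRdef, inv_mul_cancel₀ hR.ne']
  have hy₀ : y₀ - x₀ = R • ν := by rw [hνdef, smul_inv_smul₀ hR.ne']
  have hlam : 0 < lam := hF1.1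
  have hLam : 0 < Lam := hlam.trans_le hF1.2.1
  set L := (N * Lam * R⁻¹ + 1) / lam with hLdef
  have hL : 0 ≤ L := by positivity
  have hκ : 2 * L * lam - 2 * R⁻¹ * N * Lam = 2 := by
    rw [hLdef]
    field_simp
    ring
  obtain ⟨r₀, hr₀, hball⟩ := Metric.nhds_basis_closedBall.mem_iff.1 (hΩ.mem_nhds hx₀)
  obtain ⟨M, hM⟩ :=
    (isCompact_closedBall x₀ r₀).exists_bound_of_continuousOn (hu₁.mono hball)
  obtain ⟨k', hk'⟩ :=
    (isCompact_closedBall x₀ r₀).exists_bound_of_continuousOn (hk.mono hball)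
  have hM0 : 0 ≤ M := (norm_nonneg _).trans (hM x₀ (Metric.mem_closedBall_self hr₀.le))
  have hk'0 : 0 ≤ k' := (norm_nonneg _).trans (hk' x₀ (Metric.mem_closedBall_self hr₀.le))
  set c := p * M ^ (p - 1) with hcdef
  have hc : 0 ≤ c := by positivity
  set C := |μ| + k' * c with hCdef
  have hC : 0 ≤ C := by positivity
  set r := min r₀ (1 / (L + C + 1)) with hrdef
  have hr : 0 < r := by positivity
  have hr1 : r * (L + C + 1) ≤ 1 := (le_div_iff₀ (by positivity)).1 (min_le_right _ _)
  have hLr : L * r < 1 := by nlinarith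
  have hCr : C * r < 1 := by nlinarith
  have hsubset : Metric.closedBall x₀ r ⊆ Ω :=
    (Metric.closedBall_subset_closedBall (min_le_left _ _)).trans hball
  obtain ⟨s, hs, hsb⟩ := exists_pos_mul_lt_of_isCompact (isCompact_sphere x₀ r)
    (w := fun x => u₁ x - u₂ x) (continuous_barrier ν L R⁻¹ x₀)
    ((hu₁.sub hu₂).mono (Metric.sphere_subset_closedBall.trans hsubset))
    (fun x hx => sub_nonneg.2 (hle x (hsubset (Metric.sphere_subset_closedBall hx))))
    (fun x hx hb => sub_pos.2 (hlt x (hsubset (Metric.sphere_subset_closedBall hx))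
      (norm_sub_lt_of_barrier_nonneg hν hR hy₀ hL
        (by rwa [mem_sphere_iff_norm.1 hx]) (Metric.ne_of_mem_sphere hx hr.ne') hb)))
  have hb0 : barrier ν L R⁻¹ x₀ x₀ = 0 := by simp [barrier]
  have hx₀r : x₀ ∈ Metric.closedBall x₀ r := Metric.mem_closedBall_self hr.le
  obtain ⟨z, hz, hzmax, hzle⟩ := exists_max_zeroth_order_le hΩ hF1 hF3 (by linarith) hk hu₁ hu₂
    hsuper hsub (isCompact_closedBall x₀ r) ⟨x₀, hx₀r⟩ hsubset hν hs.le hL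
    (inv_nonneg.2 hR.le) (fun z hz hmax => by
      have h1 := hmax x₀ hx₀r
      rw [hb0, heq] at h1
      refine mem_interior_iff_mem_nhds.1 (Metric.ball_subset_interior_closedBall ?_)
      refine (Metric.mem_closedBall.1 hz).lt_of_ne fun h2 => ?_
      have h3 := hsb z h2
      linarith)
  have h1 := hzmax x₀ hx₀r
  rw [hb0, heq] at h1
  rw [hκ] at hzle
  have hzΩ := hsubset hz
  have hzball := Metric.closedBall_subset_closedBall (min_le_left _ _) hz
  have h2 := barrier_le hν hL (inv_nonneg.2 hR.le) hLr.le (mem_closedBall_iff_norm.1 hz)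
  have hw : 0 ≤ u₁ z - u₂ z := sub_nonneg.2 (hle z hzΩ)
  have h3 := rpow_sub_rpow_le hp (hu₂0 z hzΩ) (hle z hzΩ) ((le_abs_self _).trans (hM z hzball))
  have h4 := mul_le_mul_of_nonneg_left h3 (hk0 z hzΩ)
  have h5 : k z * (c * (u₁ z - u₂ z)) ≤ k' * (c * (u₁ z - u₂ z)) :=
    mul_le_mul_of_nonneg_right ((le_abs_self _).trans (hk' z hzball)) (by positivity)
  have h6 : -μ * (u₁ z - u₂ z) ≤ |μ| * (u₁ z - u₂ z) :=
    mul_le_mul_of_nonneg_right (neg_le_abs μ) hw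
  have h7 : s * 2 ≤ C * (u₁ z - u₂ z) := by
    rw [hCdef]
    linarith
  have h8 : C * (u₁ z - u₂ z) ≤ C * (s * (2 * r)) :=
    mul_le_mul_of_nonneg_left (by linarith [mul_le_mul_of_nonneg_left h2 hs.le]) hC
  nlinarith [mul_lt_mul_of_pos_left hCr hs]

/-- Two continuous functions on an open connected set whose contact set cannot be touched from
outside by a ball either never meet or coincide. -/
theorem forall_ne_or_forall_eq_of_contact {Ω : Set (Euc N)} {u₁ u₂ : Euc N → ℝ}
    (hΩ : IsOpen Ω) (hconn : IsPreconnected Ω)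
    (hu₁ : ContinuousOn u₁ Ω) (hu₂ : ContinuousOn u₂ Ω)
    (h : ∀ x₀ ∈ Ω, u₁ x₀ = u₂ x₀ → ∀ y₀, y₀ ≠ x₀ →
      ¬ ∀ x ∈ Ω, ‖x - y₀‖ < ‖y₀ - x₀‖ → u₁ x ≠ u₂ x) :
    (∀ x ∈ Ω, u₁ x ≠ u₂ x) ∨ ∀ x ∈ Ω, u₁ x = u₂ x := by
  have hopen : IsOpen {x | x ∈ Ω ∧ u₁ x ≠ u₂ x} := by
    have := (hu₁.sub hu₂).isOpen_inter_preimage hΩ (isOpen_compl_singleton (x := (0 : ℝ)))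
    simpa [Set.inter_def, sub_eq_zero] using this
  have hopen' : IsOpen {x | x ∈ Ω ∧ u₁ x = u₂ x} := by
    refine Metric.isOpen_iff.2 fun x₁ hx₁ => ?_
    obtain ⟨ε, hε, hball⟩ := Metric.isOpen_iff.1 hΩ x₁ hx₁.1
    refine ⟨ε / 3, by positivity, fun y₀ hy₀ => ?_⟩
    rw [Metric.mem_ball] at hy₀
    have hy₀Ω : y₀ ∈ Ω := hball (Metric.mem_ball.2 (by linarith))
    by_contra hcon
    have hsub : Metric.closedBall x₁ (2 * ε / 3) ⊆ Ω :=
      (Metric.closedBall_subset_ball (by linarith)).trans hball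
    have hcomp : IsCompact (Metric.closedBall x₁ (2 * ε / 3) \ {x | x ∈ Ω ∧ u₁ x ≠ u₂ x}) :=
      (isCompact_closedBall _ _).diff hopen
    have hmem : ∀ x, x ∈ Metric.closedBall x₁ (2 * ε / 3) \ {x | x ∈ Ω ∧ u₁ x ≠ u₂ x} ↔
        x ∈ Metric.closedBall x₁ (2 * ε / 3) ∧ u₁ x = u₂ x := fun x =>
      ⟨fun hx => ⟨hx.1, by_contra fun hne => hx.2 ⟨hsub hx.1, hne⟩⟩,
        fun hx => ⟨hx.1, fun hne => hne.2 hx.2⟩⟩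
    have hx₁mem := (hmem x₁).2 ⟨Metric.mem_closedBall_self (by positivity), hx₁.2⟩
    obtain ⟨x₀, hx₀, hmin⟩ := hcomp.exists_isMinOn ⟨x₁, hx₁mem⟩
      (f := fun x => dist x y₀) (by fun_prop)
    have hx₀' := (hmem x₀).1 hx₀
    have hne : y₀ ≠ x₀ := fun e => hcon ⟨hy₀Ω, e ▸ hx₀'.2⟩
    refine h x₀ (hsub hx₀'.1) hx₀'.2 y₀ hne fun x _ hx hxeq => ?_
    rw [← dist_eq_norm, ← dist_eq_norm, dist_comm y₀] at hx
    have h1 : dist x₀ y₀ ≤ dist x₁ y₀ := hmin hx₁mem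
    rw [dist_comm x₁] at h1
    have h2 : x ∈ Metric.closedBall x₁ (2 * ε / 3) := by
      rw [Metric.mem_closedBall]
      linarith [dist_triangle x y₀ x₁]
    have h3 : dist x₀ y₀ ≤ dist x y₀ := hmin ((hmem x).2 ⟨h2, hxeq⟩)
    linarith
  by_contra! hcon
  obtain ⟨⟨x, hx, hxe⟩, ⟨y, hy, hye⟩⟩ := hcon
  obtain ⟨z, -, hz, hz'⟩ := hconn _ _ hopen hopen'
    (fun x hx => (ne_or_eq (u₁ x) (u₂ x)).imp (⟨hx, ·⟩) (⟨hx, ·⟩)) ⟨y, hy, hy, hye⟩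
    ⟨x, hx, hx, hxe⟩
  exact hz.2 hz'.2

end Hopf

/-- strong comparison principle: if `u₁ ≥ 0` is a viscosity supersolution and
`u₂ ≥ 0` a viscosity subsolution of `F(x,D²u)+μu = k(x)u^p` in `Ω`, with `k ≥ 0`, and
`u₁ ≥ u₂` in `Ω`, then either `u₁ > u₂` everywhere in `Ω` or `u₁ ≡ u₂` in `Ω`. -/
theorem statement12 {N : ℕ} (Ω : Set (Euc N))
    (F : Euc N → Matrix (Fin N) (Fin N) ℝ → ℝ) (lam Lam p μ : ℝ)
    (k : Euc N → ℝ) (u₁ u₂ : Euc N → ℝ)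
    (hΩ : IsC2Domain Ω) (hFc : FCont Ω F)
    (hF1 : IsF1 Ω F lam Lam) (hF2 : IsF2 Ω F) (hF3 : IsF3 Ω F)
    (hp : 1 < p) (hk_cont : ContinuousOn k Ω) (hk_nonneg : ∀ x ∈ Ω, 0 ≤ k x)
    (hu₁_cont : ContinuousOn u₁ (closure Ω)) (hu₂_cont : ContinuousOn u₂ (closure Ω))
    (hu₁_nonneg : ∀ x ∈ Ω, 0 ≤ u₁ x) (hu₂_nonneg : ∀ x ∈ Ω, 0 ≤ u₂ x)
    (hsuper : ViscSupersol Ω (logisticG F μ k p) u₁)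
    (hsub : ViscSubsol Ω (logisticG F μ k p) u₂)
    (hle : ∀ x ∈ Ω, u₂ x ≤ u₁ x) :
    (∀ x ∈ Ω, u₂ x < u₁ x) ∨ ∀ x ∈ Ω, u₁ x = u₂ x := by
  have hu₁ := hu₁_cont.mono subset_closure
  have hu₂ := hu₂_cont.mono subset_closure
  refine (forall_ne_or_forall_eq_of_contact hΩ.1 hΩ.2.2.2.1.isPreconnected hu₁ hu₂
    fun x₀ hx₀ heq y₀ hne hlt => ?_).imp_left fun h x hx => (hle x hx).lt_of_ne (h x hx).symm
  exact not_forall_lt_of_contact hΩ.1 hF1 hF3 hp hk_cont hk_nonneg hu₁ hu₂ hu₂_nonneg hsuper hsub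
    hle hx₀ heq hne fun x hx hxy => (hle x hx).lt_of_ne (hlt x hx hxy).symm
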